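/- Let R be a definable ring and K a definable real closed field, and suppose there is a definable scalar multiplication K × R → R making the additive group (R, +) into a K-vector space. Then the ring multiplication of R is compatible with the scalar multiplication: (r·u)·(s·v) = (r·s)·(u·v) for all r, s ∈ K and u, v ∈ R; that is, R is a definable associative K-algebra. -/

import Mathlib

open FirstOrder

namespace OMin

variable (L : FirstOrder.Language) (M : Type) [L.Structure M]

/-- A set of tuples from `M` is *definable* (with arbitrary parameters from `M`). -/
def Defin {α : Type} (s : Set (α → M)) : Prop :=
  Set.Definable (Set.univ : Set M) L s

section Order

variable [LinearOrder M]

/-- A subset of `M` that is a single point or an open interval. -/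
def IsPointOrInterval (s : Set M) : Prop :=
  (∃ a, s = {a}) ∨ (∃ a b, s = Set.Ioo a b) ∨ (∃ a, s = Set.Ioi a) ∨
    (∃ a, s = Set.Iio a) ∨ s = Set.univ

/-- `M` (with the structure of `L` and the order `<`) is an o-minimal structure:
a structure on a dense linear order without endpoints, whose order is definable,
such that every definable subset of `M` is a finite union of points and open intervals. -/
def OMinimal : Prop :=
  DenselyOrdered M ∧ NoMinOrder M ∧ NoMaxOrder M ∧ Nonempty M ∧
    Defin L M {x : Fin 2 → M | x 0 < x 1} ∧
    ∀ s : Set M, Defin L M {x : Fin 1 → M | x 0 ∈ s} →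
      ∃ (n : ℕ) (t : Fin n → Set M), (∀ i, IsPointOrInterval M (t i)) ∧ s = ⋃ i, t i

/-- The order topology on `M`. -/
def otop : TopologicalSpace M := Preorder.topology M

/-- The product of the order topology on tuples. -/
def ptop (k : ℕ) : TopologicalSpace (Fin k → M) :=
  @Pi.topologicalSpace (Fin k) (fun _ => M) (fun _ => otop M)

/-- A definable set `S` is definably connected iff it is not the union of two disjoint
nonempty definable subsets that are open in `S`. -/
def DefConnected {k : ℕ} (S : Set (Fin k → M)) : Prop :=
  ∀ U V : Set (Fin k → M), Defin L M U → Defin L M V →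
    (∃ U', @IsOpen _ (ptop M k) U' ∧ U = U' ∩ S) →
    (∃ V', @IsOpen _ (ptop M k) V' ∧ V = V' ∩ S) →
    U ∪ V = S → U ∩ V = ∅ → (U = ∅ ∨ V = ∅)

/-- `X ⊆ M^k` has dimension at least `n`: some coordinate projection to `M^n` of `X`
has nonempty interior. -/
def DimGE {k : ℕ} (X : Set (Fin k → M)) (n : ℕ) : Prop :=
  ∃ f : Fin n → Fin k, Function.Injective f ∧
    (@interior _ (ptop M n) ((fun x : Fin k → M => x ∘ f) '' X)).Nonempty

/-- `X` has dimension exactly `n`: `n` is the largest integer such that the image of `X`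
under some coordinate projection `M^k → M^n` has nonempty interior. -/
def DimEq {k : ℕ} (X : Set (Fin k → M)) (n : ℕ) : Prop :=
  DimGE M X n ∧ ∀ m : ℕ, DimGE M X m → m ≤ n

end Order

/-- A definable abelian group: a definable set with definable group operations. -/
structure DefAbGroup where
  k : ℕ
  carrier : Set (Fin k → M)
  zero : Fin k → M
  add : (Fin k → M) → (Fin k → M) → (Fin k → M)
  neg : (Fin k → M) → (Fin k → M)
  zero_mem : zero ∈ carrier
  add_mem : ∀ x ∈ carrier, ∀ y ∈ carrier, add x y ∈ carrier
  neg_mem : ∀ x ∈ carrier, neg x ∈ carrier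
  hadd_assoc : ∀ x ∈ carrier, ∀ y ∈ carrier, ∀ z ∈ carrier,
    add (add x y) z = add x (add y z)
  hadd_comm : ∀ x ∈ carrier, ∀ y ∈ carrier, add x y = add y x
  hzero_add : ∀ x ∈ carrier, add zero x = x
  hneg_add : ∀ x ∈ carrier, add (neg x) x = zero
  carrier_def : Defin L M carrier
  add_def : Defin L M {p : (Fin k ⊕ Fin k ⊕ Fin k) → M |
    (fun i => p (Sum.inl i)) ∈ carrier ∧ (fun i => p (Sum.inr (Sum.inl i))) ∈ carrier ∧
    add (fun i => p (Sum.inl i)) (fun i => p (Sum.inr (Sum.inl i))) =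
      fun i => p (Sum.inr (Sum.inr i))}
  neg_def : Defin L M {p : (Fin k ⊕ Fin k) → M |
    (fun i => p (Sum.inl i)) ∈ carrier ∧
    neg (fun i => p (Sum.inl i)) = fun i => p (Sum.inr i)}

/-- A definable (not necessarily unital or commutative) ring: a definable abelian group
together with a definable associative multiplication distributing over the addition. -/
structure DefRing extends DefAbGroup L M where
  mul : (Fin k → M) → (Fin k → M) → (Fin k → M)
  mul_mem : ∀ x ∈ carrier, ∀ y ∈ carrier, mul x y ∈ carrier
  hmul_assoc : ∀ x ∈ carrier, ∀ y ∈ carrier, ∀ z ∈ carrier,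
    mul (mul x y) z = mul x (mul y z)
  hleft_distrib : ∀ x ∈ carrier, ∀ y ∈ carrier, ∀ z ∈ carrier,
    mul x (add y z) = add (mul x y) (mul x z)
  hright_distrib : ∀ x ∈ carrier, ∀ y ∈ carrier, ∀ z ∈ carrier,
    mul (add x y) z = add (mul x z) (mul y z)
  mul_def : Defin L M {p : (Fin k ⊕ Fin k ⊕ Fin k) → M |
    (fun i => p (Sum.inl i)) ∈ carrier ∧ (fun i => p (Sum.inr (Sum.inl i))) ∈ carrier ∧
    mul (fun i => p (Sum.inl i)) (fun i => p (Sum.inr (Sum.inl i))) =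
      fun i => p (Sum.inr (Sum.inr i))}

end OMin
namespace OMin

namespace DefAbGroup

variable {L : FirstOrder.Language} {M : Type} [L.Structure M] (G : DefAbGroup L M)

/-- `n • x` in the group `G`. -/
def nsmul : ℕ → (Fin G.k → M) → (Fin G.k → M)
  | 0, _ => G.zero
  | n + 1, x => G.add x (nsmul n x)

/-- Sum of a list of elements. -/
def listSum : List (Fin G.k → M) → (Fin G.k → M)
  | [] => G.zero
  | x :: l => G.add x (listSum l)

/-- Sum of a finitely indexed family of elements. -/
noncomputable def univSum {ι : Type} [Fintype ι] (f : ι → (Fin G.k → M)) : Fin G.k → M :=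
  G.listSum ((Finset.univ : Finset ι).toList.map f)

/-- `S` is a subgroup of `G`. -/
def IsSubgroup (S : Set (Fin G.k → M)) : Prop :=
  S ⊆ G.carrier ∧ G.zero ∈ S ∧ (∀ x ∈ S, ∀ y ∈ S, G.add x y ∈ S) ∧ ∀ x ∈ S, G.neg x ∈ S

/-- The `n`-torsion subgroup `{x : n • x = 0}`. -/
def torsion (n : ℕ) : Set (Fin G.k → M) :=
  {x | x ∈ G.carrier ∧ G.nsmul n x = G.zero}

/-- The elements of `S` have no (nontrivial) torsion. -/
def TorsionFreeOn (S : Set (Fin G.k → M)) : Prop :=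
  ∀ x ∈ S, ∀ n : ℕ, G.nsmul (n + 1) x = G.zero → x = G.zero

/-- The group `G` is torsion-free. -/
def TorsionFree : Prop := G.TorsionFreeOn G.carrier

/-- The set `S` is the internal direct sum of the family `I` of subgroups of `G`:
every element of `S` is uniquely the sum of a family of elements of the `I i`. -/
def IsInternalDirectSumOn {ι : Type} [Fintype ι] (S : Set (Fin G.k → M))
    (I : ι → Set (Fin G.k → M)) : Prop :=
  (∀ i, G.IsSubgroup (I i) ∧ I i ⊆ S) ∧
  (∀ x ∈ S, ∃ f : ι → (Fin G.k → M), (∀ i, f i ∈ I i) ∧ G.univSum f = x) ∧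
  (∀ f g : ι → (Fin G.k → M), (∀ i, f i ∈ I i) → (∀ i, g i ∈ I i) →
    G.univSum f = G.univSum g → f = g)

/-- `G` is the internal direct sum of the family `I` of subgroups. -/
def IsInternalDirectSum {ι : Type} [Fintype ι] (I : ι → Set (Fin G.k → M)) : Prop :=
  G.IsInternalDirectSumOn G.carrier I

section Order

variable [LinearOrder M]

/-- `C` is the definably connected component of `0` in `G`, i.e. the largest
definably connected definable subgroup of `G`. -/
def IsZeroComponent (C : Set (Fin G.k → M)) : Prop :=
  G.IsSubgroup C ∧ Defin L M C ∧ DefConnected L M C ∧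
    ∀ D, G.IsSubgroup D → Defin L M D → DefConnected L M D → D ⊆ C

/-- `N` is the maximal definable torsion-free subgroup of `G`. -/
def IsMaxDefTorsionFree (N : Set (Fin G.k → M)) : Prop :=
  G.IsSubgroup N ∧ Defin L M N ∧ G.TorsionFreeOn N ∧
    ∀ D, G.IsSubgroup D → Defin L M D → G.TorsionFreeOn D → D ⊆ N

end Order

end DefAbGroup

namespace DefRing

variable {L : FirstOrder.Language} {M : Type} [L.Structure M] (R : DefRing L M)

/-- `R` is a null ring: all products vanish. -/
def IsNull : Prop := ∀ x ∈ R.carrier, ∀ y ∈ R.carrier, R.mul x y = R.zero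

/-- The multiplication of `R` restricted to `S` is trivial. -/
def NullOn (S : Set (Fin R.k → M)) : Prop := ∀ x ∈ S, ∀ y ∈ S, R.mul x y = R.zero

/-- The two-sided annihilator of `X` in `R`. -/
def annOf (X : Set (Fin R.k → M)) : Set (Fin R.k → M) :=
  {a | a ∈ R.carrier ∧ ∀ x ∈ X, R.mul a x = R.zero ∧ R.mul x a = R.zero}

/-- `Ann(R)`, the two-sided annihilator of `R`. -/
def ann : Set (Fin R.k → M) := R.annOf R.carrier

/-- `powSucc x n = x^(n+1)`. -/
def powSucc (x : Fin R.k → M) : ℕ → (Fin R.k → M)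
  | 0 => x
  | n + 1 => R.mul (powSucc x n) x

/-- `upow e x n = x^n`, where `x^0 = e` (for a unital ring with identity `e`). -/
def upow (e x : Fin R.k → M) : ℕ → (Fin R.k → M)
  | 0 => e
  | n + 1 => R.mul (upow e x n) x

/-- `products S n` is the set of all products of `n` elements of `S` (for `n ≥ 1`;
by convention `products S 0 = {0}`). -/
def products (S : Set (Fin R.k → M)) : ℕ → Set (Fin R.k → M)
  | 0 => {R.zero}
  | 1 => S
  | n + 2 => {z | ∃ x ∈ S, ∃ y ∈ products S (n + 1), z = R.mul x y}

/-- `R` is a nilpotent ring: all products of some fixed length vanish. -/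
def IsNilpotentRing : Prop := ∃ m, 1 ≤ m ∧ R.products R.carrier m = {R.zero}

/-- `R` is a nil ring: every element is nilpotent. -/
def IsNilRing : Prop := ∀ x ∈ R.carrier, ∃ m : ℕ, R.powSucc x m = R.zero

/-- The set `I` is nilpotent: all products of some fixed length of elements of `I` vanish. -/
def NilpotentSet (I : Set (Fin R.k → M)) : Prop := ∃ m, 1 ≤ m ∧ R.products I m = {R.zero}

/-- `I` is a left ideal of `R`. -/
def IsLeftIdeal (I : Set (Fin R.k → M)) : Prop :=
  R.IsSubgroup I ∧ ∀ r ∈ R.carrier, ∀ x ∈ I, R.mul r x ∈ I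

/-- `I` is a right ideal of `R`. -/
def IsRightIdeal (I : Set (Fin R.k → M)) : Prop :=
  R.IsSubgroup I ∧ ∀ r ∈ R.carrier, ∀ x ∈ I, R.mul x r ∈ I

/-- `I` is a two-sided ideal of `R`. -/
def IsIdeal (I : Set (Fin R.k → M)) : Prop :=
  R.IsSubgroup I ∧ ∀ r ∈ R.carrier, ∀ x ∈ I, R.mul r x ∈ I ∧ R.mul x r ∈ I

/-- The Jacobson radical of `R`:
`J(R) = {a ∈ R : ∀ r ∈ R, ∃ b ∈ R, b·r·a − r·a − b = 0}`. -/
def jacobson : Set (Fin R.k → M) :=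
  {a | a ∈ R.carrier ∧ ∀ r ∈ R.carrier, ∃ b ∈ R.carrier,
    R.add (R.mul (R.mul b r) a) (R.add (R.neg (R.mul r a)) (R.neg b)) = R.zero}

/-- `R` is semiprime: `{0}` is its only nilpotent two-sided ideal. -/
def IsSemiprime : Prop := ∀ I, R.IsIdeal I → R.NilpotentSet I → I = {R.zero}

/-- `R` is prime: `aRb ≠ {0}` whenever `a, b ≠ 0`. -/
def IsPrimeRing : Prop := ∀ a ∈ R.carrier, a ≠ R.zero → ∀ b ∈ R.carrier, b ≠ R.zero →
    ∃ r ∈ R.carrier, R.mul (R.mul a r) b ≠ R.zero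

/-- `R` is simple: nontrivial multiplication and no nontrivial proper two-sided ideals. -/
def IsSimple : Prop := (¬ R.IsNull) ∧ ∀ I, R.IsIdeal I → I = {R.zero} ∨ I = R.carrier

/-- `R` is definably simple: nontrivial multiplication and no nontrivial proper
*definable* two-sided ideals. -/
def IsDefSimple : Prop :=
  (¬ R.IsNull) ∧ ∀ I, R.IsIdeal I → Defin L M I → I = {R.zero} ∨ I = R.carrier

/-- `e` is a (two-sided) multiplicative identity of `R`. -/
def IsIdentity (e : Fin R.k → M) : Prop :=
  e ∈ R.carrier ∧ ∀ x ∈ R.carrier, R.mul e x = x ∧ R.mul x e = x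

/-- `R` is unital. -/
def IsUnital : Prop := ∃ e, R.IsIdentity e

/-- `R` is a division ring. -/
def IsDivisionRing : Prop :=
  ∃ e, R.IsIdentity e ∧ e ≠ R.zero ∧ ∀ x ∈ R.carrier, x ≠ R.zero →
    ∃ y ∈ R.carrier, R.mul x y = e ∧ R.mul y x = e

theorem IsDivisionRing.unital {R : DefRing L M} (h : R.IsDivisionRing) : R.IsUnital :=
  h.imp fun _ he => he.1

/-- `S` is a subring (as a subset, not necessarily definable). -/
def IsSubringSet (S : Set (Fin R.k → M)) : Prop :=
  S ⊆ R.carrier ∧ R.zero ∈ S ∧ (∀ x ∈ S, ∀ y ∈ S, R.add x y ∈ S) ∧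
    (∀ x ∈ S, R.neg x ∈ S) ∧ ∀ x ∈ S, ∀ y ∈ S, R.mul x y ∈ S

/-- `S` is a definable subring of `R`. -/
def IsDefSubring (S : Set (Fin R.k → M)) : Prop :=
  Defin L M S ∧ R.IsSubringSet S

/-- `S` is the smallest definable subring of `R` containing `x`. -/
def IsSmallestDefSubringContaining (x : Fin R.k → M) (S : Set (Fin R.k → M)) : Prop :=
  R.IsDefSubring S ∧ x ∈ S ∧ ∀ T, R.IsDefSubring T → x ∈ T → S ⊆ T

/-- `e` is an idempotent element of `R`. -/
def IsIdempotent (e : Fin R.k → M) : Prop := e ∈ R.carrier ∧ R.mul e e = e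

/-- `a` and `b` are orthogonal: `a·b = b·a = 0`. -/
def Orthogonal (a b : Fin R.k → M) : Prop := R.mul a b = R.zero ∧ R.mul b a = R.zero

/-- `e` is a primitive idempotent: a nonzero idempotent that is not the sum of two
nonzero orthogonal idempotents. -/
def IsPrimitiveIdempotent (e : Fin R.k → M) : Prop :=
  R.IsIdempotent e ∧ e ≠ R.zero ∧
    ¬ ∃ a b, R.IsIdempotent a ∧ R.IsIdempotent b ∧ a ≠ R.zero ∧ b ≠ R.zero ∧
      R.Orthogonal a b ∧ R.add a b = e

/-- The set `R·e`. -/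
def leftMulSet (e : Fin R.k → M) : Set (Fin R.k → M) :=
  {z | ∃ r ∈ R.carrier, z = R.mul r e}

/-- The set `e·R`. -/
def rightMulSet (e : Fin R.k → M) : Set (Fin R.k → M) :=
  {z | ∃ r ∈ R.carrier, z = R.mul e r}

/-- The set `e·R·f`. -/
def midMulSet (e f : Fin R.k → M) : Set (Fin R.k → M) :=
  {z | ∃ r ∈ R.carrier, z = R.mul e (R.mul r f)}

/-- `I` is a minimal left ideal. -/
def IsMinimalLeftIdeal (I : Set (Fin R.k → M)) : Prop :=
  R.IsLeftIdeal I ∧ I ≠ {R.zero} ∧ ∀ J, R.IsLeftIdeal J → J ⊆ I → J = {R.zero} ∨ J = I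

/-- `I` is a minimal right ideal. -/
def IsMinimalRightIdeal (I : Set (Fin R.k → M)) : Prop :=
  R.IsRightIdeal I ∧ I ≠ {R.zero} ∧ ∀ J, R.IsRightIdeal J → J ⊆ I → J = {R.zero} ∨ J = I

/-- `R` is left Artinian: every descending chain of left ideals stabilizes. -/
def LeftArtinian : Prop :=
  ∀ f : ℕ → Set (Fin R.k → M), (∀ n, R.IsLeftIdeal (f n)) → (∀ n, f (n + 1) ⊆ f n) →
    ∃ N, ∀ n, N ≤ n → f n = f N

/-- `J` is a two-sided ideal of the (sub)ring `S`. -/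
def IsIdealOn (S J : Set (Fin R.k → M)) : Prop :=
  J ⊆ S ∧ R.zero ∈ J ∧ (∀ x ∈ J, ∀ y ∈ J, R.add x y ∈ J) ∧ (∀ x ∈ J, R.neg x ∈ J) ∧
    ∀ r ∈ S, ∀ x ∈ J, R.mul r x ∈ J ∧ R.mul x r ∈ J

/-- The (sub)ring `S` is a simple ring. -/
def SimpleOn (S : Set (Fin R.k → M)) : Prop :=
  (¬ R.NullOn S) ∧ ∀ J, R.IsIdealOn S J → J = {R.zero} ∨ J = S

/-- The (sub)ring `S` is a division ring. -/
def DivisionOn (S : Set (Fin R.k → M)) : Prop :=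
  ∃ e ∈ S, e ≠ R.zero ∧ (∀ x ∈ S, R.mul e x = x ∧ R.mul x e = x) ∧
    ∀ x ∈ S, x ≠ R.zero → ∃ y ∈ S, R.mul x y = e ∧ R.mul y x = e

/-- `R` is a (commutative) field. -/
def IsFieldRing : Prop :=
  (∀ x ∈ R.carrier, ∀ y ∈ R.carrier, R.mul x y = R.mul y x) ∧
  ∃ e, R.IsIdentity e ∧ e ≠ R.zero ∧
    ∀ x ∈ R.carrier, x ≠ R.zero → ∃ y ∈ R.carrier, R.mul x y = e

/-- Evaluation of the polynomial `∑_{i ≤ n} c i * X^i` at `x` (`e` the identity). -/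
def polyEval (e x : Fin R.k → M) (c : ℕ → (Fin R.k → M)) (n : ℕ) : Fin R.k → M :=
  R.listSum ((List.range (n + 1)).map fun i => R.mul (c i) (R.upow e x i))

/-- `R` is a real closed field: a field together with a linear order making it an
ordered field in which nonnegative elements are squares and every odd-degree polynomial
has a root. -/
def IsRealClosedDefField : Prop :=
  R.IsFieldRing ∧
  ∃ e, R.IsIdentity e ∧
  ∃ lt : (Fin R.k → M) → (Fin R.k → M) → Prop,
    (∀ x ∈ R.carrier, ¬ lt x x) ∧
    (∀ x ∈ R.carrier, ∀ y ∈ R.carrier, ∀ z ∈ R.carrier, lt x y → lt y z → lt x z) ∧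
    (∀ x ∈ R.carrier, ∀ y ∈ R.carrier, x ≠ y → lt x y ∨ lt y x) ∧
    (∀ x ∈ R.carrier, ∀ y ∈ R.carrier, ∀ z ∈ R.carrier, lt x y →
      lt (R.add x z) (R.add y z)) ∧
    (∀ x ∈ R.carrier, ∀ y ∈ R.carrier, lt R.zero x → lt R.zero y → lt R.zero (R.mul x y)) ∧
    (∀ x ∈ R.carrier, ¬ lt x R.zero → ∃ y ∈ R.carrier, R.mul y y = x) ∧
    (∀ n : ℕ, Odd n → ∀ c : ℕ → (Fin R.k → M), (∀ i, i ≤ n → c i ∈ R.carrier) →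
      c n ≠ R.zero → ∃ x ∈ R.carrier, R.polyEval e x c n = R.zero)

end DefRing

/-- A definable isomorphism of definable rings: a ring isomorphism whose graph is
definable. -/
def DefIso {L : FirstOrder.Language} {M : Type} [L.Structure M] (A B : DefRing L M) : Prop :=
  ∃ f : (Fin A.k → M) → (Fin B.k → M),
    Set.BijOn f A.carrier B.carrier ∧
    (∀ x ∈ A.carrier, ∀ y ∈ A.carrier,
      f (A.add x y) = B.add (f x) (f y) ∧ f (A.mul x y) = B.mul (f x) (f y)) ∧
    Defin L M {p : (Fin A.k ⊕ Fin B.k) → M |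
      (fun i => p (Sum.inl i)) ∈ A.carrier ∧
      f (fun i => p (Sum.inl i)) = fun i => p (Sum.inr i)}

end OMin
namespace OMin

/-- The language of rings with only the two binary operations `+` and `·`. -/
def ringLang : FirstOrder.Language :=
  ⟨fun n => match n with | 2 => Bool | _ => Empty, fun _ => Empty⟩

namespace DefRing

variable {L : FirstOrder.Language} {M : Type} [L.Structure M] (R : DefRing L M)

/-- The ring structure `(R, +, ·)` as a first-order structure on the carrier of `R`. -/
def innerStr : ringLang.Structure ↥R.carrier where
  funMap {n} f x :=
    match n, f, x with
    | 2, b, x =>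
      if (show Bool from b) then ⟨R.add ↑(x 0) ↑(x 1), R.add_mem _ (x 0).2 _ (x 1).2⟩
      else ⟨R.mul ↑(x 0) ↑(x 1), R.mul_mem _ (x 0).2 _ (x 1).2⟩
    | 0, f, _ => f.elim
    | 1, f, _ => f.elim
    | _ + 3, f, _ => f.elim
  RelMap {n} r _ := r.elim

/-- A set of tuples from the carrier of `R` that is definable in the pure ring
structure `(R, +, ·)`. -/
def InnerDefinable {α : Type} (S : Set (α → ↥R.carrier)) : Prop :=
  letI := R.innerStr
  Set.Definable (Set.univ : Set ↥R.carrier) ringLang S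

/-- A subset of `R` that is definable in the pure ring structure `(R, +, ·)`. -/
def InnerDefinableSubset (S : Set (Fin R.k → M)) : Prop :=
  S ⊆ R.carrier ∧
    R.InnerDefinable {x : Fin 1 → ↥R.carrier | ((x 0 : ↥R.carrier) : Fin R.k → M) ∈ S}

variable {R}

theorem add_zero' {x : Fin R.k → M} (hx : x ∈ R.carrier) : R.add x R.zero = x := by
  rw [R.hadd_comm x hx R.zero R.zero_mem]; exact R.hzero_add x hx

theorem add_neg' {x : Fin R.k → M} (hx : x ∈ R.carrier) : R.add x (R.neg x) = R.zero := by
  rw [R.hadd_comm x hx (R.neg x) (R.neg_mem x hx)]; exact R.hneg_add x hx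

theorem add_left_cancel' {a b c : Fin R.k → M}
    (ha : a ∈ R.carrier) (hb : b ∈ R.carrier) (hc : c ∈ R.carrier)
    (h : R.add a b = R.add a c) : b = c := by
  have hna := R.neg_mem a ha
  calc b = R.add R.zero b := (R.hzero_add b hb).symm
    _ = R.add (R.add (R.neg a) a) b := by rw [R.hneg_add a ha]
    _ = R.add (R.neg a) (R.add a b) := R.hadd_assoc _ hna _ ha _ hb
    _ = R.add (R.neg a) (R.add a c) := by rw [h]
    _ = R.add (R.add (R.neg a) a) c := (R.hadd_assoc _ hna _ ha _ hc).symm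
    _ = R.add R.zero c := by rw [R.hneg_add a ha]
    _ = c := R.hzero_add c hc

theorem zero_mul' {x : Fin R.k → M} (hx : x ∈ R.carrier) : R.mul R.zero x = R.zero := by
  have h0 := R.zero_mem
  have hm := R.mul_mem _ h0 _ hx
  apply add_left_cancel' hm hm h0
  calc R.add (R.mul R.zero x) (R.mul R.zero x)
      = R.mul (R.add R.zero R.zero) x := (R.hright_distrib _ h0 _ h0 _ hx).symm
    _ = R.mul R.zero x := by rw [R.hzero_add _ h0]
    _ = R.add (R.mul R.zero x) R.zero := (add_zero' hm).symm

theorem mul_zero' {x : Fin R.k → M} (hx : x ∈ R.carrier) : R.mul x R.zero = R.zero := by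
  have h0 := R.zero_mem
  have hm := R.mul_mem _ hx _ h0
  apply add_left_cancel' hm hm h0
  calc R.add (R.mul x R.zero) (R.mul x R.zero)
      = R.mul x (R.add R.zero R.zero) := (R.hleft_distrib _ hx _ h0 _ h0).symm
    _ = R.mul x R.zero := by rw [R.hzero_add _ h0]
    _ = R.add (R.mul x R.zero) R.zero := (add_zero' hm).symm

variable (R)

/-- The addition on the carrier of a definable ring. -/
def addSub : Add ↥R.carrier := ⟨fun a b => ⟨R.add a b, R.add_mem _ a.2 _ b.2⟩⟩

/-- The zero of the carrier of a definable ring. -/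
def zeroSub : Zero ↥R.carrier := ⟨⟨R.zero, R.zero_mem⟩⟩

/-- The negation on the carrier of a definable ring. -/
def negSub : Neg ↥R.carrier := ⟨fun a => ⟨R.neg a, R.neg_mem _ a.2⟩⟩

/-- The unital ring structure on the carrier of a unital definable ring. -/
noncomputable def ringSub (h : R.IsUnital) : Ring ↥R.carrier := by
  letI := R.addSub; letI := R.zeroSub; letI := R.negSub
  exact
  { add := fun a b => ⟨R.add a b, R.add_mem _ a.2 _ b.2⟩
    add_assoc := fun a b c => Subtype.ext (R.hadd_assoc _ a.2 _ b.2 _ c.2)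
    zero := ⟨R.zero, R.zero_mem⟩
    zero_add := fun a => Subtype.ext (R.hzero_add _ a.2)
    add_zero := fun a => Subtype.ext (add_zero' a.2)
    add_comm := fun a b => Subtype.ext (R.hadd_comm _ a.2 _ b.2)
    neg := fun a => ⟨R.neg a, R.neg_mem _ a.2⟩
    neg_add_cancel := fun a => Subtype.ext (R.hneg_add _ a.2)
    nsmul := nsmulRec
    zsmul := zsmulRec
    mul := fun a b => ⟨R.mul a b, R.mul_mem _ a.2 _ b.2⟩
    mul_assoc := fun a b c => Subtype.ext (R.hmul_assoc _ a.2 _ b.2 _ c.2)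
    one := ⟨Classical.choose h, (Classical.choose_spec h).1⟩
    one_mul := fun a => Subtype.ext (((Classical.choose_spec h).2 _ a.2).1)
    mul_one := fun a => Subtype.ext (((Classical.choose_spec h).2 _ a.2).2)
    left_distrib := fun a b c => Subtype.ext (R.hleft_distrib _ a.2 _ b.2 _ c.2)
    right_distrib := fun a b c => Subtype.ext (R.hright_distrib _ a.2 _ b.2 _ c.2)
    zero_mul := fun a => Subtype.ext (zero_mul' a.2)
    mul_zero := fun a => Subtype.ext (mul_zero' a.2)
    nsmul_zero := fun a => rfl
    nsmul_succ := fun n a => rfl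
    zsmul_zero' := fun a => rfl
    zsmul_succ' := fun n a => rfl
    zsmul_neg' := fun n a => rfl }

theorem IsFieldRing.unital {R : DefRing L M} (h : R.IsFieldRing) : R.IsUnital :=
  h.2.imp fun _ he => he.1

/-- The commutative ring structure on the carrier of a definable field. -/
noncomputable def commRingSub (h : R.IsFieldRing) : CommRing ↥R.carrier :=
  { R.ringSub h.unital with
    mul_comm := fun a b => by exact Subtype.ext (h.1 _ a.2 _ b.2) }

end DefRing

end OMin
namespace OMin

/-- `K(√-1)`: the quadratic extension `K[X]/(X² + 1)` of `K`, realized concretely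
on pairs. -/
structure Gauss (K : Type) where
  re : K
  im : K

namespace Gauss

variable {K : Type} [CommRing K]

@[ext] theorem ext {a b : Gauss K} (h1 : a.re = b.re) (h2 : a.im = b.im) : a = b := by
  cases a; cases b; cases h1; cases h2; rfl

instance : Add (Gauss K) := ⟨fun a b => ⟨a.re + b.re, a.im + b.im⟩⟩
instance : Mul (Gauss K) := ⟨fun a b => ⟨a.re * b.re - a.im * b.im, a.re * b.im + a.im * b.re⟩⟩
instance : Neg (Gauss K) := ⟨fun a => ⟨-a.re, -a.im⟩⟩
instance : Zero (Gauss K) := ⟨⟨0, 0⟩⟩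
instance : One (Gauss K) := ⟨⟨1, 0⟩⟩

@[simp] theorem add_re (a b : Gauss K) : (a + b).re = a.re + b.re := rfl
@[simp] theorem add_im (a b : Gauss K) : (a + b).im = a.im + b.im := rfl
@[simp] theorem mul_re (a b : Gauss K) : (a * b).re = a.re * b.re - a.im * b.im := rfl
@[simp] theorem mul_im (a b : Gauss K) : (a * b).im = a.re * b.im + a.im * b.re := rfl
@[simp] theorem neg_re (a : Gauss K) : (-a).re = -a.re := rfl
@[simp] theorem neg_im (a : Gauss K) : (-a).im = -a.im := rfl
@[simp] theorem zero_re : (0 : Gauss K).re = 0 := rfl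
@[simp] theorem zero_im : (0 : Gauss K).im = 0 := rfl
@[simp] theorem one_re : (1 : Gauss K).re = 1 := rfl
@[simp] theorem one_im : (1 : Gauss K).im = 0 := rfl

instance : CommRing (Gauss K) where
  add := (· + ·)
  add_assoc a b c := by ext <;> simp <;> ring
  zero := 0
  zero_add a := by ext <;> simp
  add_zero a := by ext <;> simp
  add_comm a b := by ext <;> simp <;> ring
  neg := Neg.neg
  neg_add_cancel a := by ext <;> simp
  nsmul := nsmulRec
  zsmul := zsmulRec
  mul := (· * ·)
  mul_assoc a b c := by ext <;> simp <;> ring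
  one := 1
  one_mul a := by ext <;> simp
  mul_one a := by ext <;> simp
  left_distrib a b c := by ext <;> simp <;> ring
  right_distrib a b c := by ext <;> simp <;> ring
  zero_mul a := by ext <;> simp
  mul_zero a := by ext <;> simp
  mul_comm a b := by ext <;> simp <;> ring

end Gauss

variable {L : FirstOrder.Language} {M : Type} [L.Structure M]

/-- An abstract field `F` isomorphic (as a ring, via `iso`) to the definable field `K`,
together with a finite-dimensional associative `F`-algebra `A` with nontrivial
multiplication and a (set-level) ring isomorphism `aiso` from the subring `S` of the
definable ring `R` onto `A`. -/
structure AlgebraCopy (K : DefRing L M) (R : DefRing L M) (S : Set (Fin R.k → M)) where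
  F : Type
  [fieldF : Field F]
  iso : (Fin K.k → M) → F
  bij : Set.BijOn iso K.carrier Set.univ
  map_add : ∀ x ∈ K.carrier, ∀ y ∈ K.carrier, iso (K.add x y) = iso x + iso y
  map_mul : ∀ x ∈ K.carrier, ∀ y ∈ K.carrier, iso (K.mul x y) = iso x * iso y
  A : Type
  [ringA : NonUnitalRing A]
  [moduleA : Module F A]
  [towerA : IsScalarTower F A A]
  [commA : SMulCommClass F A A]
  findim : FiniteDimensional F A
  notNull : ∃ a b : A, a * b ≠ 0
  aiso : (Fin R.k → M) → A
  abij : Set.BijOn aiso S Set.univ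
  amap_add : ∀ x ∈ S, ∀ y ∈ S, aiso (R.add x y) = aiso x + aiso y
  amap_mul : ∀ x ∈ S, ∀ y ∈ S, aiso (R.mul x y) = aiso x * aiso y

/-- The (abstract) ring `A` has nontrivial multiplication, i.e. is not a null ring. -/
def NotNullCarrier (A : Type) [NonUnitalRing A] : Prop := ∃ a b : A, a * b ≠ 0

/-- A finite-dimensional associative `F`-algebra `A` and a ring isomorphism from the
definable ring `R` onto the direct product `A × B`, for a definable ring `B`. -/
structure ProdSplit (F : Type) [Field F] (R : DefRing L M) (B : DefRing L M) where
  A : Type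
  [ringA : NonUnitalRing A]
  [moduleA : Module F A]
  [towerA : IsScalarTower F A A]
  [commA : SMulCommClass F A A]
  findim : FiniteDimensional F A
  f : (Fin R.k → M) → A × (Fin B.k → M)
  bij : Set.BijOn f R.carrier {p | p.2 ∈ B.carrier}
  map_add : ∀ x ∈ R.carrier, ∀ y ∈ R.carrier,
    f (R.add x y) = ((f x).1 + (f y).1, B.add (f x).2 (f y).2)
  map_mul : ∀ x ∈ R.carrier, ∀ y ∈ R.carrier,
    f (R.mul x y) = ((f x).1 * (f y).1, B.mul (f x).2 (f y).2)

/-- `D` (a definable ring in `M`) is a copy, via the canonical flattening of tuples,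
of the ring `Din`, which is definable in the pure ring structure `(B, +, ·)`. -/
def IsInnerCopy (B : DefRing L M) (Din : @DefRing ringLang ↥B.carrier B.innerStr)
    (D : DefRing L M) : Prop :=
  letI := B.innerStr
  ∃ e : Fin D.k ≃ (Fin Din.k × Fin B.k),
    ∃ g : (Fin Din.k → ↥B.carrier) → (Fin D.k → M),
      (∀ x i, g x i = (x (e i).1 : Fin B.k → M) (e i).2) ∧
      Set.BijOn g Din.carrier D.carrier ∧
      ∀ x ∈ Din.carrier, ∀ y ∈ Din.carrier,
        g (Din.add x y) = D.add (g x) (g y) ∧ g (Din.mul x y) = D.mul (g x) (g y)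

/-- `R` is definably isomorphic to the ring `M_n(D)` of `n × n` matrices over the
definable division ring `D`. -/
def MatrixIso (R D : DefRing L M) (hD : D.IsUnital) (n : ℕ) : Prop :=
  letI := D.ringSub hD
  ∃ f : (Fin R.k → M) → Matrix (Fin n) (Fin n) ↥D.carrier,
    Set.BijOn f R.carrier Set.univ ∧
    (∀ x ∈ R.carrier, ∀ y ∈ R.carrier,
      f (R.add x y) = f x + f y ∧ f (R.mul x y) = f x * f y) ∧
    Defin L M {p : (Fin R.k ⊕ Fin n × Fin n × Fin D.k) → M |
      (fun i => p (Sum.inl i)) ∈ R.carrier ∧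
      ∀ q : Fin n × Fin n × Fin D.k,
        ((f (fun i => p (Sum.inl i)) q.1 q.2.1 : ↥D.carrier) : Fin D.k → M) q.2.2 =
          p (Sum.inr q)}

/-- A definable scalar multiplication of the definable field `K` on the subset `S` of the
definable ring `R` making `S` a definable `K`-vector space. -/
def IsDefVectorSpaceOn (K R : DefRing L M) (S : Set (Fin R.k → M))
    (σ : (Fin K.k → M) → (Fin R.k → M) → (Fin R.k → M)) : Prop :=
  (∀ c ∈ K.carrier, ∀ x ∈ S, σ c x ∈ S) ∧
  Defin L M {p : (Fin K.k ⊕ Fin R.k ⊕ Fin R.k) → M |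
    (fun i => p (Sum.inl i)) ∈ K.carrier ∧ (fun i => p (Sum.inr (Sum.inl i))) ∈ S ∧
    σ (fun i => p (Sum.inl i)) (fun i => p (Sum.inr (Sum.inl i))) =
      fun i => p (Sum.inr (Sum.inr i))} ∧
  (∀ e, K.IsIdentity e → ∀ x ∈ S, σ e x = x) ∧
  (∀ c ∈ K.carrier, ∀ x ∈ S, ∀ y ∈ S, σ c (R.add x y) = R.add (σ c x) (σ c y)) ∧
  (∀ c ∈ K.carrier, ∀ d ∈ K.carrier, ∀ x ∈ S, σ (K.add c d) x = R.add (σ c x) (σ d x)) ∧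
  (∀ c ∈ K.carrier, ∀ d ∈ K.carrier, ∀ x ∈ S, σ (K.mul c d) x = σ c (σ d x))

/-- The subring `S` of `R` is a definable `K`-vector space and a definable associative
`K`-algebra. -/
def IsDefAlgebraOn (K R : DefRing L M) (S : Set (Fin R.k → M)) : Prop :=
  ∃ σ, IsDefVectorSpaceOn K R S σ ∧
    ∀ r ∈ K.carrier, ∀ s ∈ K.carrier, ∀ u ∈ S, ∀ v ∈ S,
      R.mul (σ r u) (σ s v) = σ (K.mul r s) (R.mul u v)

/-- `S` (a subring of the definable ring `R`) is definably isomorphic to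
`K^r × K(√-1)^p × ℍ(K)^q`, for the definable field `K`. -/
def GaussQuatIso (R : DefRing L M) (S : Set (Fin R.k → M)) (K : DefRing L M)
    (hK : K.IsFieldRing) (r p q : ℕ) : Prop :=
  letI := K.commRingSub hK
  ∃ f : (Fin R.k → M) →
      ((Fin r → ↥K.carrier) × (Fin p → Gauss ↥K.carrier) × (Fin q → Quaternion ↥K.carrier)),
    Set.BijOn f S Set.univ ∧
    (∀ x ∈ S, ∀ y ∈ S, f (R.add x y) = f x + f y ∧ f (R.mul x y) = f x * f y) ∧
    Defin L M {pp : (Fin R.k ⊕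
        ((Fin r × Fin K.k) ⊕ (Fin p × Fin 2 × Fin K.k) ⊕ (Fin q × Fin 4 × Fin K.k))) → M |
      (fun i => pp (Sum.inl i)) ∈ S ∧
      (∀ (a : Fin r) (c : Fin K.k),
        (((f (fun i => pp (Sum.inl i))).1 a : Fin K.k → M)) c =
          pp (Sum.inr (Sum.inl (a, c)))) ∧
      (∀ (a : Fin p) (c : Fin K.k),
        ((((f (fun i => pp (Sum.inl i))).2.1 a).re : Fin K.k → M)) c =
            pp (Sum.inr (Sum.inr (Sum.inl (a, 0, c)))) ∧
        ((((f (fun i => pp (Sum.inl i))).2.1 a).im : Fin K.k → M)) c =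
            pp (Sum.inr (Sum.inr (Sum.inl (a, 1, c))))) ∧
      (∀ (a : Fin q) (c : Fin K.k),
        ((((f (fun i => pp (Sum.inl i))).2.2 a).re : Fin K.k → M)) c =
            pp (Sum.inr (Sum.inr (Sum.inr (a, 0, c)))) ∧
        ((((f (fun i => pp (Sum.inl i))).2.2 a).imI : Fin K.k → M)) c =
            pp (Sum.inr (Sum.inr (Sum.inr (a, 1, c)))) ∧
        ((((f (fun i => pp (Sum.inl i))).2.2 a).imJ : Fin K.k → M)) c =
            pp (Sum.inr (Sum.inr (Sum.inr (a, 2, c)))) ∧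
        ((((f (fun i => pp (Sum.inl i))).2.2 a).imK : Fin K.k → M)) c =
            pp (Sum.inr (Sum.inr (Sum.inr (a, 3, c)))))}

end OMin
namespace OMin

section Definability

variable {L : FirstOrder.Language} {M : Type} [L.Structure M] {α β : Type}

theorem Defin.and {P Q : (α → M) → Prop} (hP : Defin L M {v | P v}) (hQ : Defin L M {v | Q v}) :
    Defin L M {v | P v ∧ Q v} :=
  Set.Definable.inter hP hQ

theorem Defin.or {P Q : (α → M) → Prop} (hP : Defin L M {v | P v}) (hQ : Defin L M {v | Q v}) :
    Defin L M {v | P v ∨ Q v} :=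
  Set.Definable.union hP hQ

theorem Defin.not {P : (α → M) → Prop} (hP : Defin L M {v | P v}) : Defin L M {v | ¬ P v} :=
  Set.Definable.compl hP

theorem Defin.imp {P Q : (α → M) → Prop} (hP : Defin L M {v | P v}) (hQ : Defin L M {v | Q v}) :
    Defin L M {v | P v → Q v} := by
  simpa only [imp_iff_not_or] using hP.not.or hQ

theorem Defin.ex {P : (α → M) → M → Prop}
    (h : Defin L M {w : α ⊕ Unit → M | P (fun a => w (Sum.inl a)) (w (Sum.inr ()))}) :
    Defin L M {v | ∃ t, P v t} := by
  refine cast (congrArg _ ?_) (Set.Definable.exists_of_finite h)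
  ext v
  exact ⟨fun ⟨u, hu⟩ => ⟨u (), hu⟩, fun ⟨t, ht⟩ => ⟨fun _ => t, ht⟩⟩

theorem Defin.all {P : (α → M) → M → Prop}
    (h : Defin L M {w : α ⊕ Unit → M | P (fun a => w (Sum.inl a)) (w (Sum.inr ()))}) :
    Defin L M {v | ∀ t, P v t} := by
  refine cast (congrArg _ ?_) (Set.Definable.forall_of_finite h)
  ext v
  exact ⟨fun hu t => hu fun _ => t, fun ht u => ht (u ())⟩

theorem definableFun_const' (a : M) : (Set.univ : Set M).DefinableFun L fun _ : α → M => a :=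
  L.definableFun_const α (Set.mem_univ a)

/-- A binary relation on `M` that is definable with parameters. -/
def DefinRel (L : FirstOrder.Language) {M : Type} [L.Structure M] (C : M → M → Prop) : Prop :=
  Defin L M {w : Fin 2 → M | C (w 0) (w 1)}

theorem DefinRel.app {C : M → M → Prop} (hC : DefinRel L C) {f g : (α → M) → M}
    (hf : (Set.univ : Set M).DefinableFun L f) (hg : (Set.univ : Set M).DefinableFun L g) :
    Defin L M {v | C (f v) (g v)} := by
  have h : (Set.univ : Set M).DefinableMap L (fun v => ![f v, g v]) := by
    simp [Set.DefinableMap, *]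
  exact Set.Definable.preimage_map h hC

/-- A subset of `M` that is definable with parameters. -/
def DefinSet (L : FirstOrder.Language) {M : Type} [L.Structure M] (S : Set M) : Prop :=
  Defin L M {x : Fin 1 → M | x 0 ∈ S}

end Definability

section Exchange

variable {L : FirstOrder.Language} {M : Type} [L.Structure M] [LinearOrder M]

theorem OMinimal.lt (hM : OMinimal L M) : DefinRel L (fun x y : M => x < y) :=
  hM.2.2.2.2.1

/-- An infinite definable set contains an open interval. -/
theorem OMinimal.exists_Ioo_subset (hM : OMinimal L M) {S : Set M} (hS : DefinSet L S)
    (hinf : S.Infinite) : ∃ a b, a < b ∧ Set.Ioo a b ⊆ S := by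
  obtain ⟨_, _, _, _, _, h⟩ := hM
  obtain ⟨n, t, ht, rfl⟩ := h S hS
  obtain ⟨i, hi⟩ : ∃ i, (t i).Infinite := by
    by_contra! hcon
    exact hinf (Set.finite_iUnion hcon)
  have key : ∃ a b, a < b ∧ Set.Ioo a b ⊆ t i := by
    rcases ht i with ⟨a, h⟩ | ⟨a, b, h⟩ | ⟨a, h⟩ | ⟨a, h⟩ | h
    · exact absurd (h ▸ Set.finite_singleton a) hi
    · obtain ⟨x, hx⟩ := hi.nonempty
      rw [h] at hx
      exact ⟨a, b, hx.1.trans hx.2, h ▸ subset_rfl⟩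
    · obtain ⟨b, hb⟩ := exists_gt a
      exact ⟨a, b, hb, h ▸ Set.Ioo_subset_Ioi_self⟩
    · obtain ⟨b, hb⟩ := exists_lt a
      exact ⟨b, a, hb, h ▸ Set.Ioo_subset_Iio_self⟩
    · obtain ⟨x, hx⟩ := hi.nonempty
      obtain ⟨b, hb⟩ := exists_gt x
      exact ⟨x, b, hb, h ▸ Set.subset_univ _⟩
  obtain ⟨a, b, hab, hsub⟩ := key
  exact ⟨a, b, hab, hsub.trans (Set.subset_iUnion t i)⟩

theorem OMinimal.Ioo_infinite (hM : OMinimal L M) {a b : M} (h : a < b) :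
    (Set.Ioo a b).Infinite :=
  have := hM.1
  Set.Ioo_infinite h

/-- A definable set accumulating at `y` from the right contains a right neighbourhood of `y`. -/
theorem OMinimal.exists_Ioo_subset_of_accumulates (hM : OMinimal L M) {S : Set M}
    (hS : DefinSet L S) {y : M} (hacc : ∀ s, y < s → ∃ x ∈ S, x ∈ Set.Ioo y s) :
    ∃ s, y < s ∧ Set.Ioo y s ⊆ S := by
  obtain ⟨_, _, _, _, _, h⟩ := hM
  obtain ⟨n, t, ht, rfl⟩ := h S hS
  obtain ⟨i, hi⟩ : ∃ i, ∀ s, y < s → ∃ x ∈ t i, x ∈ Set.Ioo y s := by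
    by_contra! hcon
    choose s hys hs using hcon
    obtain ⟨s₀, hs₀⟩ := exists_gt y
    obtain ⟨x, hx, hxy, hxs⟩ := hacc ((insert s₀ (Finset.univ.image s)).min' (by simp))
      (by simp [Finset.lt_min'_iff, hs₀, hys])
    obtain ⟨i, hi⟩ := Set.mem_iUnion.1 hx
    exact hs i x hi ⟨hxy, hxs.trans_le (Finset.min'_le _ _ (by simp))⟩
  have key : ∃ s, y < s ∧ Set.Ioo y s ⊆ t i := by
    obtain ⟨s₀, hs₀⟩ := exists_gt y
    rcases ht i with ⟨a, h⟩ | ⟨a, b, h⟩ | ⟨a, h⟩ | ⟨a, h⟩ | h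
    · obtain ⟨x, hx, hyx, -⟩ := hi s₀ hs₀
      obtain ⟨x', hx', -, hlt⟩ := hi x hyx
      rw [h, Set.mem_singleton_iff] at hx hx'
      rw [hx, hx'] at hlt
      exact absurd hlt (lt_irrefl _)
    · refine ⟨b, ?_, ?_⟩
      · obtain ⟨x, hx, hyx, -⟩ := hi s₀ hs₀
        exact hyx.trans (h ▸ hx : x ∈ Set.Ioo a b).2
      · rw [h]
        refine Set.Ioo_subset_Ioo_left (not_lt.1 fun hya => ?_)
        obtain ⟨x, hx, -, hxa⟩ := hi a hya
        exact hxa.not_gt (h ▸ hx : x ∈ Set.Ioo a b).1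
    · refine ⟨s₀, hs₀, ?_⟩
      rw [h]
      refine fun z hz => lt_of_le_of_lt (not_lt.1 fun hya => ?_) hz.1
      obtain ⟨x, hx, -, hxa⟩ := hi a hya
      exact hxa.not_gt (h ▸ hx : x ∈ Set.Ioi a)
    · refine ⟨a, ?_, h ▸ Set.Ioo_subset_Iio_self⟩
      obtain ⟨x, hx, hyx, -⟩ := hi s₀ hs₀
      exact hyx.trans (h ▸ hx : x ∈ Set.Iio a)
    · exact ⟨s₀, hs₀, h ▸ Set.subset_univ _⟩
  obtain ⟨s, hs, hsub⟩ := key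
  exact ⟨s, hs, hsub.trans (Set.subset_iUnion t i)⟩

/-- A nonempty definable set bounded below has a greatest lower bound. -/
theorem OMinimal.exists_isGLB (hM : OMinimal L M) {S : Set M}
    (hS : DefinSet L S) (hne : S.Nonempty) (hb : BddBelow S) : ∃ a, IsGLB S a := by
  obtain ⟨_, _, _, _, _, h⟩ := hM
  obtain ⟨n, t, ht, rfl⟩ := h S hS
  have key : ∀ s : Finset (Fin n), (⋃ i ∈ s, t i).Nonempty → ∃ a, IsGLB (⋃ i ∈ s, t i) a := by
    intro s
    induction s using Finset.induction_on with
    | empty => simp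
    | insert i s _ ih =>
      intro _
      rw [Finset.set_biUnion_insert]
      have hbi : BddBelow (t i) := hb.mono (Set.subset_iUnion t i)
      rcases (t i).eq_empty_or_nonempty with hi | hi
      · rw [hi, Set.empty_union]
        refine ih ?_
        rename_i hne'
        rwa [Finset.set_biUnion_insert, hi, Set.empty_union] at hne'
      have hgi : ∃ a, IsGLB (t i) a := by
        rcases ht i with ⟨a, h⟩ | ⟨a, b, h⟩ | ⟨a, h⟩ | ⟨a, h⟩ | h <;> rw [h] at hbi hi ⊢
        · exact ⟨a, isGLB_singleton⟩
        · exact ⟨a, isGLB_Ioo (Set.nonempty_Ioo.1 hi)⟩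
        · exact ⟨a, isGLB_Ioi⟩
        · exact absurd hbi (not_bddBelow_Iio a)
        · exact absurd hbi not_bddBelow_univ
      obtain ⟨a, ha⟩ := hgi
      rcases (⋃ j ∈ s, t j).eq_empty_or_nonempty with hs | hs
      · exact ⟨a, by rwa [hs, Set.union_empty]⟩
      · obtain ⟨b, hb'⟩ := ih hs
        exact ⟨a ⊓ b, ha.union hb'⟩
  simpa using key Finset.univ (by simpa using hne)

/-- If a definable family of sets over `M` has finite fibres and its members are locally
comparable, then only finitely many of its members are nonempty. -/
theorem OMinimal.finite_exists_of_locally_comparable (hM : OMinimal L M) {G : M → M → Prop}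
    (hG : DefinRel L G) (hfin : ∀ t, {x | G x t}.Finite)
    (hcomp : ∀ x₁ t₁, G x₁ t₁ → ∃ s, x₁ < s ∧
      ∀ x₂ ∈ Set.Ioo x₁ s, ∀ t₂, G x₂ t₂ → G x₁ t₂ ∨ G x₂ t₁) :
    {x | ∃ t, G x t}.Finite := by
  have := hM.1
  by_contra hinf
  have hdef : DefinSet L {x | ∃ t, G x t} := Defin.ex (hG.app (.proj _) (.proj _))
  obtain ⟨p, q, hpq, hsub⟩ := hM.exists_Ioo_subset hdef hinf
  obtain ⟨x₀, hpx, hxq⟩ := exists_between hpq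
  have hV : DefinSet L {x | x₀ < x ∧ ∃ t, G x t ∧ ∀ y, x₀ < y ∧ y < x → ¬ G y t} := by
    refine Defin.and (hM.lt.app (definableFun_const' _) (.proj _)) (Defin.ex (Defin.and
      (hG.app (.proj _) (.proj _)) (Defin.all (Defin.imp (Defin.and
        (hM.lt.app (definableFun_const' _) (.proj _)) (hM.lt.app (.proj _) (.proj _)))
        (Defin.not (hG.app (.proj _) (.proj _)))))))
  obtain ⟨s', hs', hs'V⟩ := hM.exists_Ioo_subset_of_accumulates hV (y := x₀) <| by
    intro s hs
    obtain ⟨x, hx, hxs⟩ := exists_between (lt_min hs hxq)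
    obtain ⟨t, ht⟩ := hsub ⟨hpx.trans hx, hxs.trans_le (min_le_right _ _)⟩
    have hF : ({x | G x t} ∩ Set.Ioo x₀ s).Finite := (hfin t).inter_of_left _
    obtain ⟨m, hm, hmin⟩ := Set.exists_min_image _ id hF
      ⟨x, ht, hx, hxs.trans_le (min_le_left _ _)⟩
    exact ⟨m, ⟨hm.2.1, t, hm.1, fun y hy hGy =>
      hy.2.not_ge (hmin y ⟨hGy, hy.1, hy.2.trans hm.2.2⟩)⟩, hm.2⟩
  obtain ⟨x₁, hx₁, hx₁s⟩ := exists_between hs'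
  obtain ⟨-, t₁, ht₁, -⟩ := hs'V ⟨hx₁, hx₁s⟩
  obtain ⟨s, hs, hsc⟩ := hcomp x₁ t₁ ht₁
  refine hM.Ioo_infinite (lt_min hs hx₁s) ((hfin t₁).subset fun x₂ hx₂ => ?_)
  obtain ⟨-, t₂, ht₂, ht₂'⟩ := hs'V ⟨hx₁.trans hx₂.1, hx₂.2.trans_le (min_le_right _ _)⟩
  exact (hsc x₂ ⟨hx₂.1, hx₂.2.trans_le (min_le_left _ _)⟩ t₂ ht₂).resolve_left
    (ht₂' x₁ ⟨hx₁, hx₂.1⟩)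

end Exchange

section Exchange

variable {L : FirstOrder.Language} {M : Type} [L.Structure M] [LinearOrder M]

theorem OMinimal.infinite_iff (hM : OMinimal L M) {S : Set M} (hS : DefinSet L S) :
    S.Infinite ↔ ∃ a b, a < b ∧ ∀ t, a < t ∧ t < b → t ∈ S :=
  ⟨hM.exists_Ioo_subset hS, fun ⟨_, _, hab, h⟩ => (hM.Ioo_infinite hab).mono h⟩

theorem OMinimal.finite_of_finite_fibres (hM : OMinimal L M) {C : M → M → Prop}
    (hC : DefinRel L C) (hfin : ∀ y, {x | C x y}.Finite) :
    {x | {y | C x y}.Infinite}.Finite := by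
  have := hM.1
  have := hM.2.1
  have := hM.2.2.1
  have hright : ∀ c, {x | ∃ t, c < t ∧ ∀ z, c < z ∧ z < t → C x z}.Finite := by
    intro c
    refine hM.finite_exists_of_locally_comparable ?_ ?_ ?_
    · exact Defin.and (hM.lt.app (definableFun_const' _) (.proj _))
        (Defin.all (Defin.imp (Defin.and (hM.lt.app (definableFun_const' _) (.proj _))
          (hM.lt.app (.proj _) (.proj _))) (hC.app (.proj _) (.proj _))))
    · intro t
      by_cases hct : c < t
      · obtain ⟨z, hz⟩ := exists_between hct
        exact (hfin z).subset fun x hx => hx.2 z hz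
      · simp [hct]
    · rintro x₁ t₁ ⟨h₁, h₁'⟩
      obtain ⟨s, hs⟩ := exists_gt x₁
      refine ⟨s, hs, ?_⟩
      rintro x₂ - t₂ ⟨h₂, h₂'⟩
      rcases le_total t₁ t₂ with h | h
      · exact .inr ⟨h₁, fun z hz => h₂' z ⟨hz.1, hz.2.trans_le h⟩⟩
      · exact .inl ⟨h₂, fun z hz => h₁' z ⟨hz.1, hz.2.trans_le h⟩⟩
  have hleft : {x | ∃ t, ∀ z, z < t → C x z}.Finite := by
    refine hM.finite_exists_of_locally_comparable ?_ ?_ ?_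
    · exact Defin.all (Defin.imp (hM.lt.app (.proj _) (.proj _)) (hC.app (.proj _) (.proj _)))
    · intro t
      obtain ⟨z, hz⟩ := exists_lt t
      exact (hfin z).subset fun x hx => hx z hz
    · rintro x₁ t₁ h₁
      obtain ⟨s, hs⟩ := exists_gt x₁
      refine ⟨s, hs, ?_⟩
      rintro x₂ - t₂ h₂
      rcases le_total t₁ t₂ with h | h
      · exact .inr fun z hz => h₂ z (hz.trans_le h)
      · exact .inl fun z hz => h₁ z (hz.trans_le h)
  let B : M → M → Prop := fun x e => (∃ t, e < t ∧ ∀ z, e < z ∧ z < t → C x z) ∧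
    ∀ t, t < e → ∃ z, t < z ∧ ¬ e < z ∧ ¬ C x z
  have hB : ∀ x, {y | C x y}.Infinite → ¬ (∃ t, ∀ z, z < t → C x z) → ∃ e, B x e := by
    intro x hx hxl
    obtain ⟨a, b, hab, hsub⟩ := hM.exists_Ioo_subset
      (S := {y | C x y}) (hC.app (definableFun_const' _) (.proj _)) hx
    obtain ⟨e, he⟩ := hM.exists_isGLB (S := {t | t < b ∧ ∀ z, t < z ∧ z < b → C x z})
      (Defin.and (hM.lt.app (.proj _) (definableFun_const' _)) (Defin.all (Defin.imp
        (Defin.and (hM.lt.app (.proj _) (.proj _)) (hM.lt.app (.proj _) (definableFun_const' _)))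
        (hC.app (definableFun_const' _) (.proj _))))) ⟨a, hab, hsub⟩ <| by
      by_contra hcon
      rw [not_bddBelow_iff] at hcon
      refine hxl ⟨b, fun z hz => ?_⟩
      obtain ⟨t, ht, htz⟩ := hcon z
      exact ht.2 z ⟨htz, hz⟩
    refine ⟨e, ⟨b, (he.1 ⟨hab, hsub⟩).trans_lt hab, fun z hz => ?_⟩, fun t ht => ?_⟩
    · obtain ⟨t, ht, -, htz⟩ := he.exists_between hz.1
      exact ht.2 z ⟨htz, hz.2⟩
    · by_contra! hcon
      refine ht.not_ge (he.1 ⟨ht.trans_le ((he.1 ⟨hab, hsub⟩).trans hab.le), fun z hz => ?_⟩)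
      by_cases hez : e < z
      · obtain ⟨t, ht, -, htz⟩ := he.exists_between hez
        exact ht.2 z ⟨htz, hz.2⟩
      · exact hcon z hz.1 (not_lt.1 hez)
  have hfinB : {e | ∃ z, ∃ x, B x e ∧ e < z ∧ ∀ w, e < w ∧ ¬ z < w → C x w}.Finite := by
    refine hM.finite_exists_of_locally_comparable ?_ ?_ ?_
    · exact Defin.ex (Defin.and (Defin.and (Defin.ex (Defin.and
        (hM.lt.app (.proj _) (.proj _)) (Defin.all (Defin.imp (Defin.and
          (hM.lt.app (.proj _) (.proj _)) (hM.lt.app (.proj _) (.proj _)))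
          (hC.app (.proj _) (.proj _))))))
        (Defin.all (Defin.imp (hM.lt.app (.proj _) (.proj _)) (Defin.ex (Defin.and
          (hM.lt.app (.proj _) (.proj _)) (Defin.and (Defin.not (hM.lt.app (.proj _) (.proj _)))
          (Defin.not (hC.app (.proj _) (.proj _)))))))))
        (Defin.and (hM.lt.app (.proj _) (.proj _)) (Defin.all (Defin.imp (Defin.and
          (hM.lt.app (.proj _) (.proj _)) (Defin.not (hM.lt.app (.proj _) (.proj _))))
          (hC.app (.proj _) (.proj _))))))
    · intro z
      refine Set.Finite.subset ((hfin z).biUnion (t := fun x =>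
        {e | B x e ∧ e < z ∧ ∀ w, e < w ∧ ¬ z < w → C x w}) fun x _ => ?_) ?_
      · refine Set.Subsingleton.finite ?_
        have key : ∀ e₁ e₂, e₁ < e₂ → B x e₂ → e₂ < z →
            ¬ ∀ w, e₁ < w ∧ ¬ z < w → C x w := by
          intro e₁ e₂ hlt hB₂ hz h
          obtain ⟨w, hw, hw', hC'⟩ := hB₂.2 e₁ hlt
          exact hC' (h w ⟨hw, fun hzw => hw' (hz.trans hzw)⟩)
        rintro e₁ ⟨hB₁, hz₁, h₁⟩ e₂ ⟨hB₂, hz₂, h₂⟩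
        rcases lt_trichotomy e₁ e₂ with h | h | h
        · exact absurd h₁ (key e₁ e₂ h hB₂ hz₂)
        · exact h
        · exact absurd h₂ (key e₂ e₁ h hB₁ hz₁)
      · rintro e ⟨x, hx⟩
        exact Set.mem_biUnion (hx.2.2 z ⟨hx.2.1, lt_irrefl z⟩ : C x z) hx
    · rintro e₁ z₁ ⟨x₁, hB₁, h₁, h₁'⟩
      refine ⟨z₁, h₁, ?_⟩
      rintro e₂ he₂ z₂ ⟨x₂, hB₂, h₂, h₂'⟩
      rcases le_total z₁ z₂ with h | h
      · exact .inr ⟨x₂, hB₂, he₂.2, fun w hw => h₂' w ⟨hw.1, fun h' => hw.2 (h.trans_lt h')⟩⟩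
      · exact .inl ⟨x₁, hB₁, he₂.1.trans h₂, fun w hw =>
          h₁' w ⟨hw.1, fun h' => hw.2 (h.trans_lt h')⟩⟩
  refine (hleft.union (hfinB.biUnion fun e _ => hright e)).subset fun x hx => ?_
  by_cases hxl : ∃ t, ∀ z, z < t → C x z
  · exact .inl hxl
  · obtain ⟨e, he⟩ := hB x hx hxl
    obtain ⟨t, het, ht⟩ := he.1
    obtain ⟨z, hez, hzt⟩ := exists_between het
    exact .inr (Set.mem_biUnion (show e ∈ {e | _} from ⟨z, x, he, hez, fun w hw =>
      ht w ⟨hw.1, (not_lt.1 hw.2).trans_lt hzt⟩⟩) he.1)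

theorem Defin.infinite (hM : OMinimal L M) {α : Type} {P : (α → M) → M → Prop}
    (h : Defin L M {w : α ⊕ Unit → M | P (fun a => w (Sum.inl a)) (w (Sum.inr ()))})
    [Finite α] : Defin L M {v | {t | P v t}.Infinite} := by
  have hS : ∀ v, DefinSet L {t | P v t} := by
    intro v
    have hmap : (Set.univ : Set M).DefinableMap L (fun x : Fin 1 → M =>
        (Sum.elim v fun _ => x 0 : α ⊕ Unit → M)) := by
      rintro (a | a)
      · exact definableFun_const' _
      · exact .proj _
    exact Set.Definable.preimage_map hmap h
  have hiff := fun v => hM.infinite_iff (hS v)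
  simp only [hiff]
  refine Defin.ex (Defin.ex (Defin.and (hM.lt.app (.proj _) (.proj _)) (Defin.all (Defin.imp
    (Defin.and (hM.lt.app (.proj _) (.proj _)) (hM.lt.app (.proj _) (.proj _))) ?_))))
  exact Set.Definable.preimage_comp
    (Sum.elim (fun a => Sum.inl (Sum.inl (Sum.inl a))) (fun _ => Sum.inr ())) h

/-- Quantifiers of the form `for infinitely many` commute. -/
theorem OMinimal.infinite_infinite_swap (hM : OMinimal L M) {C : M → M → Prop}
    (hC : DefinRel L C) (h : {x | {y | C x y}.Infinite}.Infinite) :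
    {y | {x | C x y}.Infinite}.Infinite := by
  by_contra hfin
  rw [Set.not_infinite] at hfin
  have hD : DefinRel L (fun x y => C x y ∧ ¬ {x' | C x' y}.Infinite) :=
    Defin.and hC (Defin.not (Defin.infinite hM (P := fun w t => C t (w 1))
      (hC.app (.proj _) (.proj _))))
  refine h ((hM.finite_of_finite_fibres hD fun y => ?_).subset fun x hx => ?_)
  · by_cases hy : {x | C x y}.Infinite
    · simp [hy]
    · exact (Set.not_infinite.1 hy).subset fun x hx => hx.1
  · exact (hx.sdiff hfin).mono fun y hy => ⟨hy.1, hy.2⟩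

end Exchange

section Fibre

open Function

variable {L : FirstOrder.Language} {M : Type} [L.Structure M] {α : Type} [DecidableEq α]

/-- The tuples that can be moved into `S` by changing the coordinate `i`. -/
def existsAt (i : α) (S : Set (α → M)) : Set (α → M) :=
  {v | ∃ t, update v i t ∈ S}

/-- The tuples that can be moved into `S` by changing the coordinate `i` in infinitely many
ways. -/
def infiniteAt (i : α) (S : Set (α → M)) : Set (α → M) :=
  {v | {t | update v i t ∈ S}.Infinite}

/-- The tuples `v` such that the fibre of `S` over the coordinates of `v` not in the list `l` has
dimension at least `m`. -/
def fibreDimGE : List α → ℕ → Set (α → M) → Set (α → M)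
  | [], 0, S => S
  | [], _ + 1, _ => ∅
  | i :: l, 0, S => existsAt i (fibreDimGE l 0 S)
  | i :: l, m + 1, S => existsAt i (fibreDimGE l (m + 1) S) ∪ infiniteAt i (fibreDimGE l m S)

theorem existsAt_mono (i : α) {S T : Set (α → M)} (h : S ⊆ T) : existsAt i S ⊆ existsAt i T :=
  fun _ ⟨t, ht⟩ => ⟨t, h ht⟩

theorem infiniteAt_mono (i : α) {S T : Set (α → M)} (h : S ⊆ T) :
    infiniteAt i S ⊆ infiniteAt i T :=
  fun _ hv => hv.mono fun _ ht => h ht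

theorem infiniteAt_subset_existsAt (i : α) (S : Set (α → M)) : infiniteAt i S ⊆ existsAt i S :=
  fun _ hv => hv.nonempty

theorem existsAt_union (i : α) (S T : Set (α → M)) :
    existsAt i (S ∪ T) = existsAt i S ∪ existsAt i T := by
  ext v
  exact exists_or

theorem infiniteAt_union (i : α) (S T : Set (α → M)) :
    infiniteAt i (S ∪ T) = infiniteAt i S ∪ infiniteAt i T := by
  ext v
  exact Set.infinite_union

theorem existsAt_comm {i j : α} (hij : i ≠ j) (S : Set (α → M)) :
    existsAt i (existsAt j S) = existsAt j (existsAt i S) := by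
  ext v
  constructor
  · rintro ⟨t, u, h⟩
    exact ⟨u, t, by rwa [update_comm hij.symm]⟩
  · rintro ⟨t, u, h⟩
    exact ⟨u, t, by rwa [update_comm hij]⟩

theorem existsAt_infiniteAt_subset {i j : α} (hij : i ≠ j) (S : Set (α → M)) :
    existsAt i (infiniteAt j S) ⊆ infiniteAt j (existsAt i S) := by
  rintro v ⟨t, ht⟩
  exact ht.mono fun u hu => ⟨t, by rwa [Set.mem_ofPred_eq, update_comm hij] at hu⟩

theorem infiniteAt_existsAt_subset {i j : α} (hij : i ≠ j) (S : Set (α → M)) :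
    infiniteAt i (existsAt j S) ⊆ existsAt j (infiniteAt i S) ∪ infiniteAt j (existsAt i S) := by
  intro v hv
  by_contra hcon
  simp only [Set.mem_union, not_or] at hcon
  refine hv (((Set.not_infinite.1 hcon.2).biUnion (t := fun u => {t | update (update v j u) i t ∈ S})
    fun u _ => ?_).subset ?_)
  · by_contra hinf
    exact hcon.1 ⟨u, hinf⟩
  · rintro t ⟨u, hu⟩
    rw [update_comm hij] at hu
    exact Set.mem_biUnion (show u ∈ {u | update v j u ∈ existsAt i S} from ⟨t, hu⟩) hu

theorem Defin.update {S : Set (α → M)} (hS : Defin L M S) (i : α) :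
    Defin L M {w : α ⊕ Unit → M | update (fun a => w (Sum.inl a)) i (w (Sum.inr ())) ∈ S} := by
  refine cast (congrArg _ ?_) (Set.Definable.preimage_comp
    (fun a => if a = i then Sum.inr () else Sum.inl a) hS)
  ext w
  simp only [Set.mem_preimage, Set.mem_ofPred_eq]
  congr! 1
  ext a
  by_cases h : a = i
  · subst h; simp
  · simp [h]

theorem Defin.existsAt {S : Set (α → M)} (hS : Defin L M S) (i : α) :
    Defin L M (existsAt i S) :=
  Defin.ex (hS.update i)

theorem fibreDimGE_succ_subset (l : List α) (m : ℕ) (S : Set (α → M)) :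
    fibreDimGE l (m + 1) S ⊆ fibreDimGE l m S := by
  induction l generalizing m with
  | nil => exact Set.empty_subset _
  | cons i l ih => cases m with
    | zero => exact Set.union_subset (existsAt_mono i (ih 0)) (infiniteAt_subset_existsAt i _)
    | succ m => exact Set.union_subset_union (existsAt_mono i (ih _)) (infiniteAt_mono i (ih _))

variable [LinearOrder M] [Finite α]

theorem Defin.infiniteAt (hM : OMinimal L M) {S : Set (α → M)} (hS : Defin L M S) (i : α) :
    Defin L M (infiniteAt i S) :=
  Defin.infinite hM (P := fun v t => Function.update v i t ∈ S) (hS.update i)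

theorem infiniteAt_comm (hM : OMinimal L M) {i j : α} (hij : i ≠ j) {S : Set (α → M)}
    (hS : Defin L M S) : infiniteAt i (infiniteAt j S) ⊆ infiniteAt j (infiniteAt i S) := by
  intro v hv
  have hC : DefinRel L (fun x y => Function.update (Function.update v i x) j y ∈ S) := by
    refine Set.Definable.preimage_map (F := fun w : Fin 2 → M =>
      Function.update (Function.update v i (w 0)) j (w 1)) (fun a => ?_) hS
    by_cases haj : a = j
    · subst haj; simpa using .proj _
    · by_cases hai : a = i
      · subst hai; simpa [haj] using .proj _
      · simpa [hai, haj] using definableFun_const' _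
  have h := hM.infinite_infinite_swap hC hv
  refine h.mono fun y hy => ?_
  simp only [update_comm hij] at hy
  exact hy

theorem Defin.fibreDimGE (hM : OMinimal L M) {S : Set (α → M)} (hS : Defin L M S) (l : List α)
    (m : ℕ) : Defin L M (fibreDimGE l m S) := by
  induction l generalizing m with
  | nil => cases m with
    | zero => exact hS
    | succ m => exact Set.definable_empty
  | cons i l ih => cases m with
    | zero => exact (ih 0).existsAt i
    | succ m => exact .union ((ih _).existsAt i) ((ih _).infiniteAt hM i)

end Fibre

section Fibre

open Function

variable {L : FirstOrder.Language} {M : Type} [L.Structure M] {α : Type} [DecidableEq α]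

theorem fibreDimGE_append_of_one_eq_empty {l' : List α} {S : Set (α → M)}
    (h : fibreDimGE l' 1 S = ∅) (l : List α) {m : ℕ} (hm : l.length < m) :
    fibreDimGE (l ++ l') m S = ∅ := by
  have hpos : ∀ n, fibreDimGE l' (n + 1) S = ∅ := by
    intro n
    induction n with
    | zero => exact h
    | succ n ih => exact Set.subset_empty_iff.1 (ih ▸ fibreDimGE_succ_subset l' (n + 1) S)
  induction l generalizing m with
  | nil =>
    obtain ⟨m, rfl⟩ := Nat.exists_eq_succ_of_ne_zero (Nat.ne_zero_of_lt hm)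
    exact hpos m
  | cons i l ih =>
    obtain ⟨m, rfl⟩ := Nat.exists_eq_succ_of_ne_zero (Nat.ne_zero_of_lt hm)
    rw [List.length_cons, Nat.succ_lt_succ_iff] at hm
    simp [fibreDimGE, ih hm, ih (hm.trans (Nat.lt_succ_self m)), existsAt, infiniteAt]

theorem fibreDimGE_zero_iff {l : List α} {S : Set (α → M)} {v : α → M} :
    v ∈ fibreDimGE l 0 S ↔ ∃ w ∈ S, ∀ a ∉ l, w a = v a := by
  induction l generalizing v with
  | nil =>
    refine ⟨fun h => ⟨v, h, fun _ _ => rfl⟩, ?_⟩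
    rintro ⟨w, hw, h⟩
    rwa [show v = w from funext fun a => (h a List.not_mem_nil).symm]
  | cons i l ih =>
    constructor
    · rintro ⟨t, ht⟩
      obtain ⟨w, hw, h⟩ := ih.1 ht
      refine ⟨w, hw, fun a ha => ?_⟩
      simp only [List.mem_cons, not_or] at ha
      rw [h a ha.2, update_of_ne ha.1]
    · rintro ⟨w, hw, h⟩
      refine ⟨w i, ih.2 ⟨w, hw, fun a ha => ?_⟩⟩
      by_cases hai : a = i
      · subst hai; simp
      · rw [update_of_ne hai, h a (by simp [hai, ha])]

theorem exists_ne_of_mem_fibreDimGE_one {l : List α} (hl : l.Nodup) {S : Set (α → M)} {v : α → M}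
    (hv : v ∈ fibreDimGE l 1 S) :
    ∃ w ∈ S, ∃ w' ∈ S, w ≠ w' ∧ ∀ a ∉ l, w a = w' a := by
  induction l generalizing v with
  | nil => exact absurd hv (Set.notMem_empty v)
  | cons i l ih =>
    rw [List.nodup_cons] at hl
    rcases hv with ⟨t, ht⟩ | hv
    · obtain ⟨w, hw, w', hw', hne, h⟩ := ih hl.2 ht
      exact ⟨w, hw, w', hw', hne, fun a ha => h a fun h' => ha (List.mem_cons_of_mem i h')⟩
    · obtain ⟨t, ht, u, hu, htu⟩ := (Set.Infinite.nontrivial hv)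
      obtain ⟨w, hw, hwt⟩ := fibreDimGE_zero_iff.1 ht
      obtain ⟨w', hw', hwu⟩ := fibreDimGE_zero_iff.1 hu
      refine ⟨w, hw, w', hw', fun h => htu ?_, fun a ha => ?_⟩
      · have := congrFun h i
        rwa [hwt i hl.1, hwu i hl.1, update_self, update_self] at this
      · simp only [List.mem_cons, not_or] at ha
        rw [hwt a ha.2, hwu a ha.2, update_of_ne ha.1, update_of_ne ha.1]

theorem mem_fibreDimGE_append {l l' : List α} {m : ℕ} {S : Set (α → M)} {v w : α → M}
    (hw : w ∈ fibreDimGE l' m S) (h : ∀ a ∉ l, w a = v a) : v ∈ fibreDimGE (l ++ l') m S := by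
  induction l generalizing v with
  | nil => rwa [show v = w from funext fun a => (h a List.not_mem_nil).symm]
  | cons i l ih =>
    have key : update v i (w i) ∈ fibreDimGE (l ++ l') m S := by
      refine ih fun a ha => ?_
      by_cases hai : a = i
      · subst hai; simp
      · rw [update_of_ne hai, h a (by simp [hai, ha])]
    cases m with
    | zero => exact ⟨w i, key⟩
    | succ m => exact .inl ⟨w i, key⟩

theorem mem_fibreDimGE_append_succ {l l' : List α} {m : ℕ} {S : Set (α → M)} {v : α → M}
    (hinf : {w | w ∈ fibreDimGE l' m S ∧ ∀ a ∉ l, w a = v a}.Infinite) :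
    v ∈ fibreDimGE (l ++ l') (m + 1) S := by
  induction l generalizing v with
  | nil =>
    refine absurd ((Set.finite_singleton v).subset ?_) hinf
    rintro w ⟨-, hw⟩
    exact funext fun a => hw a List.not_mem_nil
  | cons i l ih =>
    let W : M → Set (α → M) :=
      fun t => {w | w ∈ fibreDimGE l' m S ∧ ∀ a ∉ l, w a = update v i t a}
    by_cases h : ∃ t, (W t).Infinite
    · obtain ⟨t, ht⟩ := h
      exact .inl ⟨t, ih ht⟩
    · refine .inr fun hfin => hinf ((hfin.biUnion (t := W) fun t _ => ?_).subset ?_)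
      · exact by_contra fun h' => h ⟨t, h'⟩
      · rintro w ⟨hw, hwv⟩
        have hmem : ∀ a ∉ l, w a = update v i (w i) a := by
          intro a ha
          by_cases hai : a = i
          · subst hai; simp
          · rw [update_of_ne hai, hwv a (by simp [hai, ha])]
        exact Set.mem_biUnion (show w i ∈ {t | update v i t ∈ fibreDimGE (l ++ l') m S} from
          mem_fibreDimGE_append hw hmem) ⟨hw, hmem⟩

variable [LinearOrder M] [Finite α]

theorem fibreDimGE_swap_subset (hM : OMinimal L M) {S : Set (α → M)} (hS : Defin L M S)
    (i j : α) (l : List α) (m : ℕ) :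
    fibreDimGE (i :: j :: l) m S ⊆ fibreDimGE (j :: i :: l) m S := by
  rcases eq_or_ne i j with rfl | hij
  · exact subset_rfl
  have hEE := fun T : Set (α → M) => (existsAt_comm hij T).subset
  have hEI := fun T : Set (α → M) => existsAt_infiniteAt_subset hij T
  have hIE := fun T : Set (α → M) => infiniteAt_existsAt_subset hij T
  have hII := infiniteAt_comm hM hij (hS.fibreDimGE hM l (m - 2))
  match m, hII with
  | 0, _ => exact hEE _
  | 1, _ =>
    simp only [fibreDimGE, existsAt_union]
    rintro v ((h | h) | h)
    · exact .inl (.inl (hEE _ h))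
    · exact .inr (hEI _ h)
    · exact (hIE _ h).imp .inr id
  | m + 2, hII =>
    simp only [fibreDimGE, existsAt_union, infiniteAt_union]
    rintro v ((h | h) | (h | h))
    · exact .inl (.inl (hEE _ h))
    · exact .inr (.inl (hEI _ h))
    · exact (hIE _ h).imp .inr .inl
    · exact .inr (.inr (hII h))

theorem fibreDimGE_perm (hM : OMinimal L M) {S : Set (α → M)} (hS : Defin L M S)
    {l l' : List α} (h : l.Perm l') (m : ℕ) : fibreDimGE l m S = fibreDimGE l' m S := by
  induction h generalizing m with
  | nil => rfl
  | cons i _ ih => cases m <;> simp only [fibreDimGE, ih]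
  | swap i j l =>
    exact (fibreDimGE_swap_subset hM hS j i l m).antisymm (fibreDimGE_swap_subset hM hS i j l m)
  | trans _ _ ih₁ ih₂ => rw [ih₁, ih₂]

/-- An infinite definable set has no definable embedding of a power of it into a space of smaller
dimension. -/
theorem OMinimal.le_of_definable_injOn (hM : OMinimal L M) {n k N : ℕ} {F : Set (Fin n → M)}
    (hF : F.Infinite) {θ : (Fin N → Fin n → M) → (Fin k → M)}
    (hθ : Set.InjOn θ {x | ∀ j, x j ∈ F})
    (hdef : Defin L M {w : (Fin N × Fin n) ⊕ Fin k → M |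
      (∀ j, (fun i => w (Sum.inl (j, i))) ∈ F) ∧
        θ (fun j i => w (Sum.inl (j, i))) = fun i => w (Sum.inr i)}) : N ≤ k := by
  set Γ := {w : (Fin N × Fin n) ⊕ Fin k → M | (∀ j, (fun i => w (Sum.inl (j, i))) ∈ F) ∧
    θ (fun j i => w (Sum.inl (j, i))) = fun i => w (Sum.inr i)} with hΓ
  let tgt : List ((Fin N × Fin n) ⊕ Fin k) := (List.finRange k).map Sum.inr
  let blk : Fin N → List ((Fin N × Fin n) ⊕ Fin k) :=
    fun j => (List.finRange n).map fun i => Sum.inl (j, i)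
  have hmem : ∀ js : List (Fin N), ∀ a, Sum.inl a ∈ js.flatMap blk ↔ a.1 ∈ js := by
    rintro js ⟨j, i⟩
    simp [blk]
  have key : ∀ js : List (Fin N), js.Nodup → ∀ v : (Fin N × Fin n) ⊕ Fin k → M,
      (∀ j ∉ js, (fun i => v (Sum.inl (j, i))) ∈ F) →
      v ∈ fibreDimGE (js.flatMap blk ++ tgt) js.length Γ := by
    intro js
    induction js with
    | nil =>
      intro _ v hv
      refine fibreDimGE_zero_iff.2 ⟨Sum.elim (fun a => v (Sum.inl a))
        (θ fun j i => v (Sum.inl (j, i))), ⟨fun j => hv j List.not_mem_nil, rfl⟩, ?_⟩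
      rintro (a | a) ha
      · rfl
      · exact absurd ha (by simp [tgt])
    | cons j js ih =>
      intro hjs v hv
      rw [List.nodup_cons] at hjs
      rw [List.flatMap_cons, List.append_assoc]
      refine mem_fibreDimGE_append_succ ?_
      let e : (Fin n → M) → ((Fin N × Fin n) ⊕ Fin k → M) := fun f =>
        Sum.elim (fun a => if a.1 = j then f a.2 else v (Sum.inl a)) fun a => v (Sum.inr a)
      have he : Function.Injective e := fun f g h => funext fun i => by
        simpa [e] using congrFun h (Sum.inl (j, i))
      refine (hF.image he.injOn).mono ?_
      rintro _ ⟨f, hf, rfl⟩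
      refine ⟨ih hjs.2 _ fun j' hj' => ?_, ?_⟩
      · by_cases h : j' = j
        · simpa [e, h] using hf
        · simpa [e, h] using hv j' (by simp [h, hj'])
      · rintro (⟨j', i⟩ | a) ha
        · by_cases h : j' = j
          · exact absurd ha (by simp [blk, h])
          · simp [e, h]
        · rfl
  by_contra! hlt
  have hsrc : ((List.finRange N).flatMap blk).Nodup := by
    rw [List.nodup_flatMap]
    refine ⟨fun j _ => (List.nodup_finRange n).map fun i i' h => by simpa using h, ?_⟩
    refine (List.nodup_finRange N).imp fun {j j'} hjj' a ha ha' => ?_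
    simp only [blk, List.mem_map, List.mem_finRange, true_and] at ha ha'
    obtain ⟨i, rfl⟩ := ha
    obtain ⟨i', h⟩ := ha'
    simp only [Sum.inl.injEq, Prod.mk.injEq] at h
    exact hjj' h.1.symm
  have h1 : fibreDimGE ((List.finRange N).flatMap blk) 1 Γ = ∅ := by
    refine Set.eq_empty_of_forall_notMem fun v hv => ?_
    obtain ⟨w, hw, w', hw', hne, h⟩ := exists_ne_of_mem_fibreDimGE_one hsrc hv
    have hr : ∀ a, w (Sum.inr a) = w' (Sum.inr a) := fun a => h _ (by simp [blk])
    have hl := hθ hw.1 hw'.1 (by rw [hw.2, hw'.2]; exact funext hr)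
    refine hne (funext ?_)
    rintro (⟨j, i⟩ | a)
    · exact congrFun (congrFun hl j) i
    · exact hr a
  obtain ⟨f, hf⟩ := hF.nonempty
  obtain ⟨t₀⟩ := hM.2.2.2.1
  have hv := key _ (List.nodup_finRange N)
    (Sum.elim (fun a => f a.2) fun _ => t₀) (by simp)
  rw [fibreDimGE_perm hM hdef List.perm_append_comm,
    fibreDimGE_append_of_one_eq_empty h1 _ (by simpa [tgt] using hlt)] at hv
  exact hv

end Fibre

section RealClosed

open Polynomial IntermediateField Module

/-- A Galois extension has an intermediate field of any given prime power codegree dividing the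
degree. -/
theorem exists_intermediateField_finrank_eq {F E : Type*} [Field F] [Field E] [Algebra F E]
    [FiniteDimensional F E] [IsGalois F E] (p : ℕ) [Fact p.Prime] {n : ℕ}
    (h : p ^ n ∣ finrank F E) : ∃ K : IntermediateField F E, finrank K E = p ^ n := by
  rw [← IsGalois.card_aut_eq_finrank] at h
  obtain ⟨H, hH⟩ := Sylow.exists_subgroup_card_pow_prime p h
  exact ⟨fixedField H, by rw [finrank_fixedField_eq_card, hH]⟩

/-- A field all of whose elements are squares has no quadratic extension. -/
theorem finrank_ne_two_of_isSquare {F E : Type*} [Field F] [CharZero F] [Field E] [Algebra F E]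
    (hF : ∀ x : F, IsSquare x) : finrank F E ≠ 2 := by
  intro h
  have : FiniteDimensional F E := .of_finrank_pos (by omega)
  obtain ⟨x, hx⟩ := Field.exists_primitive_element F E
  have hint : IsIntegral F x := .of_finite F x
  have hdeg := (Field.primitive_element_iff_minpoly_natDegree_eq F x).1 hx
  rw [h] at hdeg
  have hirr := minpoly.irreducible hint
  obtain ⟨s, hs⟩ := hF (discrim ((minpoly F x).coeff 2) ((minpoly F x).coeff 1)
    ((minpoly F x).coeff 0))
  have ha : (minpoly F x).coeff 2 ≠ 0 := by
    rw [← hdeg]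
    exact (leadingCoeff_ne_zero.2 hirr.ne_zero)
  have hroot := (quadratic_eq_zero_iff ha hs _).2 (.inl rfl)
  have := degree_eq_one_of_irreducible_of_root hirr (show IsRoot _
      ((-(minpoly F x).coeff 1 + s) / (2 * (minpoly F x).coeff 2)) by
    rw [IsRoot.def, eval_eq_sum_range, hdeg]
    simp only [Finset.sum_range_succ, Finset.sum_range_zero]
    refine Eq.trans ?_ hroot
    ring)
  rw [degree_eq_natDegree hirr.ne_zero, hdeg] at this
  norm_num at this

variable {K : Type*} [Field K] [IsRealClosed K]

theorem IsRealClosed.finrank_eq_one_of_odd [CharZero K] {E : Type*} [Field E] [Algebra K E]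
    (h : Odd (finrank K E)) : finrank K E = 1 := by
  have : FiniteDimensional K E := .of_finrank_pos h.pos
  obtain ⟨x, hx⟩ := Field.exists_primitive_element K E
  rw [← (Field.primitive_element_iff_minpoly_natDegree_eq K x).1 hx] at h ⊢
  have hirr := minpoly.irreducible (IsIntegral.of_finite K x)
  obtain ⟨y, hy⟩ := IsRealClosed.exists_isRoot_of_odd_natDegree h
  exact natDegree_eq_of_degree_eq_some (degree_eq_one_of_irreducible_of_root hirr hy)

/-- Every element `a + b * i` has a square root. -/
theorem IsRealClosed.exists_sq_eq_add_mul [LinearOrder K] [IsStrictOrderedRing K] {E : Type*}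
    [Field E] [Algebra K E] {i : E} (hi : i ^ 2 = -1) (a b : K) :
    ∃ x y : K, (algebraMap K E x + algebraMap K E y * i) ^ 2 =
      algebraMap K E a + algebraMap K E b * i := by
  obtain ⟨r, hr, hr2⟩ : ∃ r : K, 0 ≤ r ∧ r * r = a ^ 2 + b ^ 2 := by
    obtain ⟨r, hr⟩ := IsRealClosed.nonneg_iff_isSquare.1 (show 0 ≤ a ^ 2 + b ^ 2 by positivity)
    exact ⟨|r|, abs_nonneg r, by rw [abs_mul_abs_self, hr]⟩
  have hra : |a| ≤ r := abs_le_of_sq_le_sq (by nlinarith [sq_nonneg b]) hr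
  obtain ⟨x, hx⟩ := IsRealClosed.nonneg_iff_isSquare.1
    (show 0 ≤ (r + a) / 2 by linarith [neg_le_of_abs_le hra])
  obtain ⟨y, hy⟩ := IsRealClosed.nonneg_iff_isSquare.1
    (show 0 ≤ (r - a) / 2 by linarith [le_of_abs_le hra])
  have key : ∀ y' : K, y' * y' = y * y → 2 * x * y' = b → ∃ x y : K,
      (algebraMap K E x + algebraMap K E y * i) ^ 2 = algebraMap K E a + algebraMap K E b * i := by
    intro y' h1 h2
    refine ⟨x, y', ?_⟩
    have h3 : a = x * x - y' * y' := by linear_combination hx - hy + h1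
    rw [h3, ← h2]
    simp only [map_sub, map_mul, map_ofNat]
    linear_combination (algebraMap K E y') ^ 2 * hi
  have hxy : (2 * x * y) ^ 2 = b ^ 2 := by linear_combination -2 * (r - a) * hx - 4 * x ^ 2 * hy + hr2
  rcases sq_eq_sq_iff_eq_or_eq_neg.1 hxy with h | h
  · exact key y rfl h
  · exact key (-y) (by ring) (by linear_combination -h)

theorem IsRealClosed.isSquare_adjoin [LinearOrder K] [IsStrictOrderedRing K] {E : Type*}
    [Field E] [Algebra K E] {i : E} (hi : i ^ 2 = -1) (z : K⟮i⟯) : IsSquare z := by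
  have hint : IsIntegral K i := ⟨X ^ 2 + 1, by monicity!, by simp [hi]⟩
  have hz : ∃ a b : K, (z : E) = algebraMap K E a + algebraMap K E b * i := by
    have hz' := z.2
    rw [← mem_toSubalgebra, adjoin_simple_toSubalgebra_of_isAlgebraic hint.isAlgebraic] at hz'
    generalize (z : E) = w at hz' ⊢
    induction hz' using Algebra.adjoin_induction with
    | mem x hx => exact ⟨0, 1, by simpa using hx⟩
    | algebraMap r => exact ⟨r, 0, by simp⟩
    | add x y _ _ hx hy =>
      obtain ⟨a, b, rfl⟩ := hx
      obtain ⟨c, d, rfl⟩ := hy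
      exact ⟨a + c, b + d, by simp only [map_add]; ring⟩
    | mul x y _ _ hx hy =>
      obtain ⟨a, b, rfl⟩ := hx
      obtain ⟨c, d, rfl⟩ := hy
      refine ⟨a * c - b * d, a * d + b * c, ?_⟩
      simp only [map_add, map_sub, map_mul]
      linear_combination algebraMap K E b * algebraMap K E d * hi
  obtain ⟨a, b, hab⟩ := hz
  obtain ⟨x, y, hxy⟩ := IsRealClosed.exists_sq_eq_add_mul hi a b
  refine ⟨algebraMap K _ x + algebraMap K _ y * AdjoinSimple.gen K i, Subtype.ext ?_⟩
  rw [hab, ← hxy, sq]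
  rfl

theorem IsRealClosed.adjoin_eq_top_of_isGalois [LinearOrder K] [IsStrictOrderedRing K] {E : Type*}
    [Field E] [Algebra K E] [FiniteDimensional K E] [IsGalois K E] {i : E} (hi : i ^ 2 = -1) :
    K⟮i⟯ = ⊤ := by
  have h2 : Fact (Nat.Prime 2) := ⟨Nat.prime_two⟩
  obtain ⟨n, m, hm, hnm⟩ := Nat.exists_eq_two_pow_mul_odd (n := finrank K E) finrank_pos.ne'
  obtain ⟨F, hF⟩ := exists_intermediateField_finrank_eq (F := K) (E := E) 2 (n := n)
    (hnm ▸ dvd_mul_right _ _)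
  have hFm : finrank K F = m := by
    have := finrank_mul_finrank K F E
    rw [hF, hnm, mul_comm] at this
    exact Nat.eq_of_mul_eq_mul_left (by positivity) this
  rw [← hFm] at hm
  rw [← hFm, finrank_eq_one_of_odd hm, mul_one] at hnm
  have hdvd : finrank K⟮i⟯ E ∣ 2 ^ n := hnm ▸
      ⟨_, (mul_comm _ _).trans (finrank_mul_finrank K K⟮i⟯ E) |>.symm⟩
  obtain ⟨k, -, hk⟩ := (Nat.dvd_prime_pow Nat.prime_two).1 hdvd
  cases k with
  | zero => exact finrank_eq_one_iff_eq_top.1 hk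
  | succ k =>
    obtain ⟨F', hF'⟩ := exists_intermediateField_finrank_eq (F := K⟮i⟯) (E := E) 2 (n := k)
      (hk ▸ pow_dvd_pow 2 k.le_succ)
    have := finrank_mul_finrank K⟮i⟯ F' E
    rw [hF', hk, pow_succ, mul_comm] at this
    exact absurd (Nat.eq_of_mul_eq_mul_left (by positivity) this)
      (finrank_ne_two_of_isSquare (isSquare_adjoin hi))

/-- The fundamental theorem of algebra for real closed fields. -/
theorem IsRealClosed.adjoin_eq_top [LinearOrder K] [IsStrictOrderedRing K] {Ω : Type*}
    [Field Ω] [Algebra K Ω] [IsAlgClosed Ω] [Algebra.IsAlgebraic K Ω] {i : Ω} (hi : i ^ 2 = -1) :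
    K⟮i⟯ = ⊤ := by
  refine eq_top_iff.2 fun x _ => ?_
  have hfin : FiniteDimensional K K⟮i, x⟯ :=
    finiteDimensional_adjoin fun y _ => (Algebra.IsAlgebraic.isAlgebraic y).isIntegral
  let N := normalClosure K K⟮i, x⟯ Ω
  have hle : K⟮i, x⟯ ≤ N := le_normalClosure _
  have hiN : i ∈ N := hle (subset_adjoin K _ (by simp))
  have hxN : x ∈ N := hle (subset_adjoin K _ (by simp))
  have : IsAlgClosure K Ω := ⟨‹_›, ‹_›⟩
  have : Normal K Ω := IsAlgClosure.normal K Ω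
  have : IsGalois K N := ⟨⟩
  have htop := adjoin_eq_top_of_isGalois (K := K) (E := N) (i := ⟨i, hiN⟩) (Subtype.ext hi)
  have hmap : K⟮i⟯ = (K⟮(⟨i, hiN⟩ : N)⟯).map N.val := by
    rw [adjoin_map]; simp
  rw [hmap, htop]
  exact ⟨⟨x, hxN⟩, trivial, rfl⟩

end RealClosed

section FiniteIndex

open Polynomial IntermediateField Module

/-- A primitive root of unity of prime order `p` lies in every subfield of codegree `p`. -/
theorem primitiveRoots_nonempty_of_finrank_eq {F E : Type*} [Field F] [CharZero F] [Field E]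
    [IsAlgClosed E] [Algebra F E] {p : ℕ} (hp : p.Prime) (h : finrank F E = p) :
    (primitiveRoots p F).Nonempty := by
  have : FiniteDimensional F E := .of_finrank_pos (h ▸ hp.pos)
  have : CharZero E := charZero_of_injective_algebraMap (algebraMap F E).injective
  have : NeZero p := ⟨hp.ne_zero⟩
  obtain ⟨ζ, hζ⟩ := HasEnoughRootsOfUnity.exists_primitiveRoot E p
  have hint : IsIntegral F ζ := .of_finite F ζ
  have hlt : (minpoly F ζ).natDegree < p := by
    have hdvd : minpoly F ζ ∣ cyclotomic p F := by
      refine minpoly.dvd F ζ ?_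
      rw [aeval_def, eval₂_eq_eval_map, map_cyclotomic]
      exact hζ.isRoot_cyclotomic hp.pos
    calc _ ≤ (cyclotomic p F).natDegree := natDegree_le_of_dvd hdvd (cyclotomic_ne_zero p F)
      _ = p - 1 := by rw [natDegree_cyclotomic, Nat.totient_prime hp]
      _ < p := Nat.sub_one_lt hp.ne_zero
  have h1 : (minpoly F ζ).natDegree = 1 :=
    ((Nat.dvd_prime hp).1 (h ▸ minpoly.degree_dvd hint)).resolve_right hlt.ne
  obtain ⟨z, rfl⟩ := minpoly.mem_range_of_degree_eq_one F ζ
    ((degree_eq_iff_natDegree_eq (minpoly.ne_zero hint)).2 h1)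
  exact ⟨z, (mem_primitiveRoots hp.pos).2 (hζ.of_map_of_injective (algebraMap F E).injective)⟩

/-- An algebraically closed field of characteristic zero has no subfield of prime codegree
containing a square root of `-1`. -/
theorem not_prime_finrank_of_isAlgClosed {F E : Type*} [Field F] [CharZero F] [Field E]
    [IsAlgClosed E] [Algebra F E] [IsGalois F E] (hi : ∃ i : F, i ^ 2 = -1) :
    ¬ (finrank F E).Prime := by
  intro hp
  have : FiniteDimensional F E := .of_finrank_pos hp.pos
  have hcyc : IsCyclic Gal(E/F) := by
    have : Fact (finrank F E).Prime := ⟨hp⟩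
    exact isCyclic_of_prime_card (IsGalois.card_aut_eq_finrank F E)
  obtain ⟨α, ⟨a, ha⟩, hα⟩ := exists_root_adjoin_eq_top_of_isCyclic F E
    (primitiveRoots_nonempty_of_finrank_eq hp rfl)
  set p := finrank F E
  have hdeg := (Field.primitive_element_iff_minpoly_natDegree_eq F α).1 hα
  have hmon : (X ^ p - C a).Monic := monic_X_pow_sub_C a hp.ne_zero
  have hmin : minpoly F α = X ^ p - C a := by
    refine (eq_of_monic_of_dvd_of_natDegree_le (minpoly.monic (.of_finite F α)) hmon
      (minpoly.dvd F α (p := X ^ p - C a) (by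
        rw [map_sub, map_pow, aeval_X, aeval_C, ha, sub_self])) ?_).symm
    rw [hdeg, natDegree_X_pow_sub_C]
  have hirr : Irreducible (X ^ p - C a) := hmin ▸ minpoly.irreducible (.of_finite F α)
  have hnorm : Algebra.norm F α = (-1) ^ (p + 1) * a := by
    have hint : IsIntegral F α := .of_finite F α
    have htop : Algebra.adjoin F {α} = ⊤ := by
      rw [← adjoin_simple_toSubalgebra_of_isAlgebraic hint.isAlgebraic, hα, top_toSubalgebra]
    have h := Algebra.PowerBasis.norm_gen_eq_coeff_zero_minpoly
      (PowerBasis.ofAdjoinEqTop' hint htop)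
    rw [PowerBasis.ofAdjoinEqTop'_gen, PowerBasis.ofAdjoinEqTop'_dim, hdeg, hmin] at h
    rw [h, coeff_sub, coeff_X_pow, if_neg hp.ne_zero.symm, coeff_C_zero]
    ring
  obtain ⟨c, hc⟩ := IsAlgClosed.exists_pow_nat_eq α hp.pos
  have hNc : Algebra.norm F c ^ p = (-1) ^ (p + 1) * a := by rw [← hnorm, ← hc, map_pow]
  have hno := (X_pow_sub_C_irreducible_iff_of_prime hp).1 hirr
  rcases hp.eq_two_or_odd' with h2 | hodd
  · obtain ⟨i, hi⟩ := hi
    refine hno (i * Algebra.norm F c) ?_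
    rw [mul_pow, hNc, h2, hi]
    ring
  · exact hno _ (hNc.trans (by rw [(hodd.add_one).neg_one_pow, one_mul]))

/-- An algebraically closed field of characteristic zero has no proper subfield of finite codegree
containing a square root of `-1`. -/
theorem finrank_eq_one_of_isAlgClosed {F E : Type*} [Field F] [CharZero F] [Field E]
    [IsAlgClosed E] [Algebra F E] [FiniteDimensional F E] (hi : ∃ i : F, i ^ 2 = -1) :
    finrank F E = 1 := by
  by_contra hne
  have : IsAlgClosure F E := ⟨‹_›, inferInstance⟩
  have : Normal F E := IsAlgClosure.normal F E
  have : IsGalois F E := ⟨⟩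
  obtain ⟨p, hp, hdvd⟩ := Nat.exists_prime_and_dvd hne
  have : Fact p.Prime := ⟨hp⟩
  obtain ⟨F', hF'⟩ := exists_intermediateField_finrank_eq (F := F) (E := E) p (n := 1)
    (by rwa [pow_one])
  obtain ⟨i, hi⟩ := hi
  refine not_prime_finrank_of_isAlgClosed (F := F') (E := E)
    ⟨algebraMap F F' i, by rw [← map_pow, hi, map_neg, map_one]⟩ ?_
  rwa [hF', pow_one]

/-- A real closed field has no proper subfield of finite codegree. -/
theorem IsRealClosed.surjective_algebraMap {F K : Type*} [Field F] [Field K] [LinearOrder K]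
    [IsStrictOrderedRing K] [IsRealClosed K] [Algebra F K] [FiniteDimensional F K] :
    Function.Surjective (algebraMap F K) := by
  have : CharZero F := (algebraMap F K).charZero
  let Ω := AlgebraicClosure K
  obtain ⟨i, hi⟩ := IsAlgClosed.exists_pow_nat_eq (-1 : Ω) two_pos
  have htop := adjoin_eq_top (K := K) hi
  have hintK : IsIntegral K i := ⟨X ^ 2 + 1, by monicity!, by simp [hi]⟩
  have hintF : IsIntegral F i := ⟨X ^ 2 + 1, by monicity!, by simp [hi]⟩
  have hΩ : finrank K Ω = (minpoly K i).natDegree := by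
    rw [← adjoin.finrank hintK, htop, finrank_top']
  have : FiniteDimensional K Ω := .of_finrank_pos (hΩ ▸ minpoly.natDegree_pos hintK)
  have : FiniteDimensional F Ω := .trans F K Ω
  have h1 : finrank F⟮i⟯ Ω = 1 := finrank_eq_one_of_isAlgClosed
    ⟨AdjoinSimple.gen F i, Subtype.ext hi⟩
  have h2 : finrank F F⟮i⟯ ≤ 2 := by
    rw [adjoin.finrank hintF]
    refine (natDegree_le_of_dvd (minpoly.dvd F i (p := X ^ 2 + 1) (by simp [hi])) ?_).trans ?_
    · exact Monic.ne_zero (by monicity!)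
    · compute_degree
  have h3 : 2 ≤ finrank K Ω := by
    rw [hΩ, minpoly.two_le_natDegree_iff hintK]
    rintro ⟨j, rfl⟩
    rw [← map_pow, ← map_one (algebraMap K Ω), ← map_neg] at hi
    nlinarith [(algebraMap K Ω).injective hi, sq_nonneg j]
  have h4 : finrank F K = 1 := by
    have h5 := finrank_mul_finrank F K Ω
    have h6 := finrank_mul_finrank F F⟮i⟯ Ω
    have := finrank_pos (R := F) (M := K)
    rw [h1] at h6
    nlinarith
  exact (Module.Free.bijective_algebraMap_of_finrank_eq_one h4).2

end FiniteIndex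

section Maps

variable {L : FirstOrder.Language} {M : Type} [L.Structure M] {α : Type} {a b c : ℕ}

/-- The restriction of `θ` to `A` is a definable map. -/
def DefinMapOn (L : FirstOrder.Language) {M : Type} [L.Structure M] {α : Type} {a : ℕ}
    (A : Set (α → M)) (θ : (α → M) → (Fin a → M)) : Prop :=
  Defin L M {w : α ⊕ Fin a → M | (fun i => w (Sum.inl i)) ∈ A ∧
    θ (fun i => w (Sum.inl i)) = fun i => w (Sum.inr i)}

theorem Defin.eqFun {β : Type} (f g : Fin a → β) :
    Defin L M {w : β → M | (fun i => w (f i)) = fun i => w (g i)} := by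
  simp only [funext_iff]
  refine cast (congrArg _ ?_) (Set.definable_iInter_of_finite (A := Set.univ) (L := L)
    (f := fun i : Fin a => {w : β → M | w (f i) = w (g i)}) fun i => ?_)
  · ext w; simp
  · have h : Defin L M {w : Fin 2 → M | w 0 = w 1} := by
      refine ⟨(FirstOrder.Language.var 0).equal (FirstOrder.Language.var 1), ?_⟩
      ext w; simp
    exact Set.Definable.preimage_comp ![f i, g i] h

theorem definMapOn_proj {A : Set (α → M)} (hA : Defin L M A) (f : Fin a → α) :
    DefinMapOn L A (fun w i => w (f i)) :=
  Defin.and (Set.Definable.preimage_comp Sum.inl hA)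
    (Defin.eqFun (fun i => Sum.inl (f i)) Sum.inr)

theorem definMapOn_const {A : Set (α → M)} (hA : Defin L M A) (x : Fin a → M) :
    DefinMapOn L A (fun _ => x) := by
  refine Defin.and (Set.Definable.preimage_comp Sum.inl hA) ?_
  have h : Defin L M {w : Fin a → M | x = w} := by
    refine cast (congrArg (Set.Definable Set.univ L) ?_)
      (Set.definable_iInter_of_finite fun i => Set.Definable.preimage_comp (![i] : Fin 1 → Fin a)
        (Set.Definable.singleton_of_mem (L := L) (Set.mem_univ (x i))))
    ext w
    simp [funext_iff, eq_comm, Set.preimage]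
  exact Set.Definable.preimage_comp (Sum.inr : Fin a → α ⊕ Fin a) h

theorem DefinMapOn.comp {A : Set (α → M)} {S : Set (Fin a → M)}
    {op : (Fin a → M) → (Fin b → M)} (hop : DefinMapOn L S op)
    {f : (α → M) → (Fin a → M)} (hf : DefinMapOn L A f) (hfS : ∀ v ∈ A, f v ∈ S) :
    DefinMapOn L A (fun v => op (f v)) := by
  have h1 := Set.Definable.preimage_comp (Sum.elim (fun i => Sum.inl (Sum.inl i)) Sum.inr :
    α ⊕ Fin a → (α ⊕ Fin b) ⊕ Fin a) hf
  have h2 := Set.Definable.preimage_comp (Sum.elim Sum.inr (fun i => Sum.inl (Sum.inr i)) :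
    Fin a ⊕ Fin b → (α ⊕ Fin b) ⊕ Fin a) hop
  refine cast (congrArg (Set.Definable Set.univ L) ?_)
    (Set.Definable.exists_of_finite (h1.inter h2))
  ext w
  constructor
  · rintro ⟨x, ⟨hA, hx⟩, -, h⟩
    change f (fun i => w (Sum.inl i)) = x at hx
    subst hx
    exact ⟨hA, h⟩
  · rintro ⟨hA, h⟩
    exact ⟨_, ⟨hA, rfl⟩, hfS _ hA, h⟩

theorem DefinMapOn.comp₂ {A : Set (α → M)} {S : Set (Fin a → M)} {T : Set (Fin b → M)}
    {op : (Fin a → M) → (Fin b → M) → (Fin c → M)}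
    (hop : Defin L M {p : (Fin a ⊕ Fin b ⊕ Fin c) → M |
      (fun i => p (Sum.inl i)) ∈ S ∧ (fun i => p (Sum.inr (Sum.inl i))) ∈ T ∧
      op (fun i => p (Sum.inl i)) (fun i => p (Sum.inr (Sum.inl i))) =
        fun i => p (Sum.inr (Sum.inr i))})
    {f : (α → M) → (Fin a → M)} (hf : DefinMapOn L A f) (hfS : ∀ v ∈ A, f v ∈ S)
    {g : (α → M) → (Fin b → M)} (hg : DefinMapOn L A g) (hgT : ∀ v ∈ A, g v ∈ T) :
    DefinMapOn L A (fun v => op (f v) (g v)) := by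
  have h1 := Set.Definable.preimage_comp (Sum.elim (fun i => Sum.inl (Sum.inl (Sum.inl i)))
    (fun i => Sum.inl (Sum.inr i)) : α ⊕ Fin a → ((α ⊕ Fin c) ⊕ Fin a) ⊕ Fin b) hf
  have h2 := Set.Definable.preimage_comp (Sum.elim (fun i => Sum.inl (Sum.inl (Sum.inl i)))
    Sum.inr : α ⊕ Fin b → ((α ⊕ Fin c) ⊕ Fin a) ⊕ Fin b) hg
  have h3 := Set.Definable.preimage_comp (Sum.elim (fun i => Sum.inl (Sum.inr i))
    (Sum.elim Sum.inr (fun i => Sum.inl (Sum.inl (Sum.inr i)))) :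
      Fin a ⊕ Fin b ⊕ Fin c → ((α ⊕ Fin c) ⊕ Fin a) ⊕ Fin b) hop
  refine cast (congrArg (Set.Definable Set.univ L) ?_)
    (Set.Definable.exists_of_finite (Set.Definable.exists_of_finite ((h1.inter h2).inter h3)))
  ext w
  constructor
  · rintro ⟨x, y, ⟨⟨hA, hx⟩, -, hy⟩, -, -, h⟩
    change f (fun i => w (Sum.inl i)) = x at hx
    change g (fun i => w (Sum.inl i)) = y at hy
    subst hx hy
    exact ⟨hA, h⟩
  · rintro ⟨hA, h⟩
    exact ⟨_, _, ⟨⟨hA, rfl⟩, hA, rfl⟩, hfS _ hA, hgT _ hA, h⟩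

theorem DefinMapOn.eq {A : Set (α → M)} {f g : (α → M) → (Fin a → M)}
    (hf : DefinMapOn L A f) (hg : DefinMapOn L A g) : Defin L M {v | v ∈ A ∧ f v = g v} := by
  refine cast (congrArg _ ?_) (Set.Definable.exists_of_finite (hf.inter hg))
  ext v
  constructor
  · rintro ⟨x, ⟨hA, hx⟩, -, hy⟩
    exact ⟨hA, hx.trans hy.symm⟩
  · rintro ⟨hA, h⟩
    exact ⟨_, ⟨hA, rfl⟩, hA, h.symm⟩

theorem DefinMapOn.listSum (G : DefAbGroup L M) {ι : Type} {A : Set (α → M)} (hA : Defin L M A)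
    {f : ι → (α → M) → (Fin G.k → M)} (hf : ∀ i, DefinMapOn L A (f i))
    (hmem : ∀ i, ∀ v ∈ A, f i v ∈ G.carrier) (l : List ι) :
    DefinMapOn L A (fun v => G.listSum (l.map fun i => f i v)) ∧
      ∀ v ∈ A, G.listSum (l.map fun i => f i v) ∈ G.carrier := by
  induction l with
  | nil => exact ⟨definMapOn_const hA _, fun _ _ => G.zero_mem⟩
  | cons i l ih =>
    exact ⟨.comp₂ G.add_def (hf i) (hmem i) ih.1 ih.2,
      fun v hv => G.add_mem _ (hmem i v hv) _ (ih.2 v hv)⟩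

end Maps

section Subfields

variable {L : FirstOrder.Language} {M : Type} [L.Structure M]

theorem DefAbGroup.coe_list_sum {G : DefAbGroup L M} [AddMonoid ↥G.carrier]
    (h0 : ((0 : ↥G.carrier) : Fin G.k → M) = G.zero)
    (hadd : ∀ a b : ↥G.carrier, ((a + b : ↥G.carrier) : Fin G.k → M) = G.add a b)
    (l : List ↥G.carrier) :
    ((l.sum : ↥G.carrier) : Fin G.k → M) = G.listSum (l.map Subtype.val) := by
  induction l with
  | nil => exact h0
  | cons a l ih => rw [List.sum_cons, hadd, ih]; rfl

/-- The field structure on the carrier of a definable real closed field, which has no proper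
subfield of finite codegree. -/
theorem DefRing.IsRealClosedDefField.exists_field {K : DefRing L M}
    (hK : K.IsRealClosedDefField) :
    ∃ _ : Field ↥K.carrier, CharZero ↥K.carrier ∧
      (∀ S : Subfield ↥K.carrier, FiniteDimensional S ↥K.carrier → S = ⊤) ∧
      ((0 : ↥K.carrier) : Fin K.k → M) = K.zero ∧ K.IsIdentity ((1 : ↥K.carrier) : Fin K.k → M) ∧
      (∀ a b : ↥K.carrier, ((a + b : ↥K.carrier) : Fin K.k → M) = K.add a b) ∧
      ∀ a b : ↥K.carrier, ((a * b : ↥K.carrier) : Fin K.k → M) = K.mul a b := by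
  classical
  obtain ⟨hF, e, he, lt, hirr, htrans, htri, hadd, hmul, hsq, hroot⟩ := hK
  have huniq : ∀ e', K.IsIdentity e' → e' = e := fun e' he' =>
    ((he.2 e' he'.1).1.symm.trans (he'.2 e he.1).2)
  let := K.commRingSub hF
  have h0 : ((0 : ↥K.carrier) : Fin K.k → M) = K.zero := rfl
  have h1 : ((1 : ↥K.carrier) : Fin K.k → M) = e := huniq _ (Classical.choose_spec hF.unital)
  have hA : ∀ a b : ↥K.carrier, ((a + b : ↥K.carrier) : Fin K.k → M) = K.add a b :=
    fun _ _ => rfl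
  have hM : ∀ a b : ↥K.carrier, ((a * b : ↥K.carrier) : Fin K.k → M) = K.mul a b :=
    fun _ _ => rfl
  have hfield : IsField ↥K.carrier := by
    obtain ⟨e', he', hne, hinv⟩ := hF.2
    rw [huniq e' he'] at hne hinv
    refine ⟨⟨1, 0, fun h => hne ?_⟩, mul_comm, fun {a} ha => ?_⟩
    · rw [← h1, h, h0]
    · obtain ⟨y, hy, hay⟩ := hinv a a.2 fun h => ha (Subtype.ext h)
      exact ⟨⟨y, hy⟩, Subtype.ext (hay.trans h1.symm)⟩
  let : Field ↥K.carrier := hfield.toField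
  let r : ↥K.carrier → ↥K.carrier → Prop := fun a b => lt a b
  have : IsStrictTotalOrder ↥K.carrier r :=
    { irrefl := fun a => hirr a a.2
      trans := fun a b c => htrans a a.2 b b.2 c c.2
      trichotomous := fun a b hab hba => by
        by_contra hne
        rcases htri a a.2 b b.2 fun h => hne (Subtype.ext h) with h | h
        exacts [hab h, hba h] }
  let : LinearOrder ↥K.carrier := linearOrderOfSTO r
  have hlt : ∀ a b : ↥K.carrier, a < b ↔ lt a b := fun _ _ => Iff.rfl
  have : IsOrderedAddMonoid ↥K.carrier :=
    { add_le_add_left := fun a b hab c => by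
        rcases hab.eq_or_lt with rfl | hab
        · exact le_rfl
        · exact le_of_lt ((hlt _ _).2 (hadd a a.2 b b.2 c c.2 hab)) }
  have : Nontrivial ↥K.carrier := hfield.nontrivial
  have hpos : ∀ a b : ↥K.carrier, 0 < a → 0 < b → 0 < a * b := fun a b => hmul a a.2 b b.2
  have : ZeroLEOneClass ↥K.carrier := ⟨by
    by_contra! h
    have := hpos (-1) (-1) (neg_pos.2 h) (neg_pos.2 h)
    rw [neg_mul_neg, one_mul] at this
    exact lt_asymm h this⟩
  have : IsStrictOrderedRing ↥K.carrier := .of_mul_pos hpos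
  refine ⟨inferInstance, inferInstance, fun S _ => ?_, h0, h1 ▸ he, hA, hM⟩
  suffices IsRealClosed ↥K.carrier by
    refine eq_top_iff.2 fun a _ => ?_
    obtain ⟨b, rfl⟩ := IsRealClosed.surjective_algebraMap (F := S) a
    exact b.2
  refine .of_linearOrderedField (fun {x} hx => ?_) fun {f} hf => ?_
  · obtain ⟨y, hy, hyx⟩ := hsq x x.2 hx.not_gt
    exact ⟨⟨y, hy⟩, Subtype.ext hyx.symm⟩
  · obtain ⟨x, hx, hfx⟩ := hroot _ hf (fun i => f.coeff i) (fun i _ => (f.coeff i).2) fun h => by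
      have : f = 0 := Polynomial.leadingCoeff_eq_zero.1 (Subtype.ext h)
      simp [this] at hf
    have hpow : ∀ n, ((⟨x, hx⟩ ^ n : ↥K.carrier) : Fin K.k → M) = K.upow e x n := fun n => by
      induction n with
      | zero => rw [pow_zero, h1]; rfl
      | succ n ih => rw [pow_succ, hM, ih]; rfl
    refine ⟨⟨x, hx⟩, Subtype.ext ?_⟩
    rw [h0, ← hfx, DefRing.polyEval, Polynomial.eval_eq_sum_range, Finset.sum, Finset.range_val,
      Multiset.range, Multiset.map_coe, Multiset.sum_coe, DefAbGroup.coe_list_sum h0 hA,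
      List.map_map]
    simp only [Function.comp_def, hM, hpow]

end Subfields

section Scalars

variable {L : FirstOrder.Language} {M : Type} [L.Structure M]

theorem OMinimal.card_le_of_linearIndependent [LinearOrder M] (hM : OMinimal L M) {K : DefRing L M}
    [Field ↥K.carrier] (h0 : ((0 : ↥K.carrier) : Fin K.k → M) = K.zero)
    (hadd : ∀ a b : ↥K.carrier, ((a + b : ↥K.carrier) : Fin K.k → M) = K.add a b)
    (hmul : ∀ a b : ↥K.carrier, ((a * b : ↥K.carrier) : Fin K.k → M) = K.mul a b)
    {S : Subfield ↥K.carrier} (hS : Defin L M (Subtype.val '' (S : Set ↥K.carrier)))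
    (hinf : (S : Set ↥K.carrier).Infinite) {N : ℕ} {x : Fin N → ↥K.carrier}
    (hx : LinearIndependent S x) : N ≤ K.k := by
  set F : Set (Fin K.k → M) := Subtype.val '' (S : Set ↥K.carrier) with hF
  have hFK : F ⊆ K.carrier := by rintro _ ⟨a, -, rfl⟩; exact a.2
  let A : Set (Fin N × Fin K.k → M) := {w | ∀ j, (fun i => w (j, i)) ∈ F}
  have hA : Defin L M A := by
    refine cast (congrArg (Set.Definable Set.univ L) ?_) (Set.definable_iInter_of_finite fun j =>
      Set.Definable.preimage_comp (fun i => (j, i)) hS)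
    ext w
    simp [A, Set.preimage, Function.comp_def]
  refine hM.le_of_definable_injOn (hinf.image Subtype.val_injective.injOn)
    (θ := fun w => K.listSum ((List.finRange N).map fun j => K.mul (w j) (x j))) ?_ ?_
  · have key : ∀ c : Fin N → S,
        K.listSum ((List.finRange N).map fun j => K.mul ((c j : ↥K.carrier) : Fin K.k → M) (x j)) =
          ((∑ j, c j • x j : ↥K.carrier) : Fin K.k → M) := fun c => by
      rw [Fin.sum_univ_def, DefAbGroup.coe_list_sum h0 hadd, List.map_map]
      simp only [Function.comp_def, Subfield.smul_def, smul_eq_mul, hmul]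
    intro w hw w' hw' h
    choose c hcS hc using hw
    choose c' hcS' hc' using hw'
    obtain rfl : (fun j => (c j : Fin K.k → M)) = w := funext hc
    obtain rfl : (fun j => (c' j : Fin K.k → M)) = w' := funext hc'
    have h' := Subtype.ext ((key fun j => ⟨c j, hcS j⟩).symm.trans
      (h.trans (key fun j => ⟨c' j, hcS' j⟩)))
    have hcc := hx.fintypeLinearCombination_injective
      (a₁ := fun j => ⟨c j, hcS j⟩) (a₂ := fun j => ⟨c' j, hcS' j⟩)
      (by simpa [Fintype.linearCombination_apply] using h')
    funext j
    exact congrArg (fun a : S => ((a : ↥K.carrier) : Fin K.k → M)) (congrFun hcc j)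
  · exact (DefinMapOn.listSum K.toDefAbGroup hA
      (fun j : Fin N => DefinMapOn.comp₂ K.mul_def (definMapOn_proj hA fun i => (j, i))
        (fun v hv => hFK (hv j)) (definMapOn_const hA (x j)) fun _ _ => (x j).2)
      (fun j v hv => K.mul_mem _ (hFK (hv j)) _ (x j).2) _).1

/-- A definable field without proper subfields of finite codegree has no proper definable
subfields. -/
theorem OMinimal.subfield_eq_top [LinearOrder M] (hM : OMinimal L M) {K : DefRing L M}
    [Field ↥K.carrier] [CharZero ↥K.carrier]
    (hfin : ∀ S : Subfield ↥K.carrier, FiniteDimensional S ↥K.carrier → S = ⊤)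
    (h0 : ((0 : ↥K.carrier) : Fin K.k → M) = K.zero)
    (hadd : ∀ a b : ↥K.carrier, ((a + b : ↥K.carrier) : Fin K.k → M) = K.add a b)
    (hmul : ∀ a b : ↥K.carrier, ((a * b : ↥K.carrier) : Fin K.k → M) = K.mul a b)
    {S : Subfield ↥K.carrier} (hS : Defin L M (Subtype.val '' (S : Set ↥K.carrier))) : S = ⊤ := by
  have hinf : (S : Set ↥K.carrier).Infinite :=
    Set.infinite_of_injective_forall_mem Nat.cast_injective fun n : ℕ => natCast_mem S n
  have hrank : Module.rank S ↥K.carrier ≤ K.k := by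
    refine rank_le fun s hs => ?_
    exact hM.card_le_of_linearIndependent h0 hadd hmul hS hinf
      (hs.comp s.equivFin.symm s.equivFin.symm.injective)
  exact hfin S (Module.rank_lt_aleph0_iff.1 (hrank.trans_lt Cardinal.natCast_lt_aleph0))

/-- The scalars `c` such that the additive map `φ` commutes with multiplication by `c`. -/
def scalarSubfield {F V W : Type*} [Field F] [AddCommGroup V] [Module F V] [AddCommGroup W]
    [Module F W] (φ : V →+ W) : Subfield F where
  carrier := {c | ∀ x, φ (c • x) = c • φ x}
  zero_mem' x := by simp
  one_mem' x := by simp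
  add_mem' ha hb x := by rw [add_smul, map_add, ha, hb, add_smul]
  neg_mem' ha x := by rw [neg_smul, map_neg, ha, neg_smul]
  mul_mem' ha hb x := by rw [mul_smul, ha, hb, mul_smul]
  inv_mem' c hc x := by
    rcases eq_or_ne c 0 with rfl | h
    · simp
    · rw [eq_inv_smul_iff₀ h, ← hc, smul_inv_smul₀ h]

/-- The group structure on the carrier of a definable abelian group. -/
@[reducible]
def DefAbGroup.addCommGroupSub (G : DefAbGroup L M) : AddCommGroup ↥G.carrier :=
  let : AddGroup ↥G.carrier :=
    letI : Zero ↥G.carrier := ⟨⟨G.zero, G.zero_mem⟩⟩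
    letI : Add ↥G.carrier := ⟨fun a b => ⟨G.add a b, G.add_mem _ a.2 _ b.2⟩⟩
    letI : Neg ↥G.carrier := ⟨fun a => ⟨G.neg a, G.neg_mem _ a.2⟩⟩
    AddGroup.ofLeftAxioms (fun a b c => Subtype.ext (G.hadd_assoc _ a.2 _ b.2 _ c.2))
      (fun a => Subtype.ext (G.hzero_add _ a.2)) (fun a => Subtype.ext (G.hneg_add _ a.2))
  { add_comm := fun a b => Subtype.ext (G.hadd_comm _ a.2 _ b.2) }

/-- Definable endomorphisms of the additive group of a definable vector space over a definable
real closed field are linear. -/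
theorem IsDefVectorSpaceOn.map_smul [LinearOrder M] (hM : OMinimal L M) {K R : DefRing L M}
    (hK : K.IsRealClosedDefField) {σ : (Fin K.k → M) → (Fin R.k → M) → (Fin R.k → M)}
    (hσ : IsDefVectorSpaceOn K R R.carrier σ) {φ : (Fin R.k → M) → (Fin R.k → M)}
    (hφ : ∀ x ∈ R.carrier, φ x ∈ R.carrier)
    (hφadd : ∀ x ∈ R.carrier, ∀ y ∈ R.carrier, φ (R.add x y) = R.add (φ x) (φ y))
    (hφdef : DefinMapOn L R.carrier φ) :
    ∀ c ∈ K.carrier, ∀ x ∈ R.carrier, φ (σ c x) = σ c (φ x) := by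
  obtain ⟨_, _, hfin, h0, h1, hadd, hmul⟩ := hK.exists_field
  obtain ⟨hσmem, hσdef, hσone, hσadd, haddσ, hmulσ⟩ := hσ
  let := R.addCommGroupSub
  let : SMul ↥K.carrier ↥R.carrier := ⟨fun c x => ⟨σ c x, hσmem c c.2 x x.2⟩⟩
  let : Module ↥K.carrier ↥R.carrier := Module.ofMinimalAxioms
    (fun c x y => Subtype.ext (hσadd c c.2 x x.2 y y.2))
    (fun c d x => Subtype.ext <| by
      change σ (c + d : ↥K.carrier) x = _
      rw [hadd, haddσ c c.2 d d.2 x x.2]; rfl)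
    (fun c d x => Subtype.ext <| by
      change σ (c * d : ↥K.carrier) x = _
      rw [hmul, hmulσ c c.2 d d.2 x x.2]; rfl)
    (fun x => Subtype.ext (hσone _ h1 x x.2))
  let S : Subfield ↥K.carrier := scalarSubfield (V := ↥R.carrier)
    (AddMonoidHom.mk' (fun x => (⟨φ x, hφ x x.2⟩ : ↥R.carrier))
      fun x y => Subtype.ext (hφadd x x.2 y y.2))
  let A : Set (Fin K.k ⊕ Fin R.k → M) :=
    {w | (fun i => w (Sum.inl i)) ∈ K.carrier ∧ (fun i => w (Sum.inr i)) ∈ R.carrier}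
  have hA : Defin L M A :=
    .and (K.carrier_def.preimage_comp Sum.inl) (R.carrier_def.preimage_comp Sum.inr)
  have hc := definMapOn_proj hA Sum.inl
  have hx := definMapOn_proj hA Sum.inr
  have hB := DefinMapOn.eq
    (hφdef.comp (.comp₂ hσdef hc (fun _ h => h.1) hx fun _ h => h.2)
      fun _ h => hσmem _ h.1 _ h.2)
    (.comp₂ hσdef hc (fun _ h => h.1) (hφdef.comp hx fun _ h => h.2) fun _ h => hφ _ h.2)
  have hS : S = ⊤ := by
    refine hM.subfield_eq_top hfin h0 hadd hmul ?_
    refine cast (congrArg (Set.Definable Set.univ L) ?_)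
      (Defin.and K.carrier_def (Set.Definable.forall_of_finite (Defin.imp hA hB)))
    ext c
    constructor
    · rintro ⟨hc, h⟩
      exact ⟨⟨c, hc⟩, fun x => Subtype.ext (h x ⟨hc, x.2⟩).2, rfl⟩
    · rintro ⟨c, hc, rfl⟩
      exact ⟨c.2, fun x hx => ⟨hx, congrArg Subtype.val (hc ⟨x, hx.2⟩)⟩⟩
  intro c hc x hx
  have : (⟨c, hc⟩ : ↥K.carrier) ∈ S := hS ▸ Subfield.mem_top _
  exact congrArg Subtype.val (this ⟨x, hx⟩)

end Scalars

/-- If a definable ring `R` is a definable vector space over a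
definable real closed field `K` (via a definable scalar multiplication `σ`), then the
ring multiplication is automatically compatible with the scalar multiplication:
`(r • u)·(s • v) = (r·s) • (u·v)`, i.e. `R` is a definable associative `K`-algebra. -/
theorem statement_17 {L : FirstOrder.Language} {M : Type} [L.Structure M] [LinearOrder M]
    (hM : OMinimal L M) (K R : DefRing L M) (hK : K.IsRealClosedDefField)
    (σ : (Fin K.k → M) → (Fin R.k → M) → (Fin R.k → M))
    (hσ : IsDefVectorSpaceOn K R R.carrier σ) :
    ∀ r ∈ K.carrier, ∀ s ∈ K.carrier, ∀ u ∈ R.carrier, ∀ v ∈ R.carrier,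
      R.mul (σ r u) (σ s v) = σ (K.mul r s) (R.mul u v) := by
  intro r hr s hs u hu v hv
  have hid := definMapOn_proj R.carrier_def id
  have hru := hσ.1 r hr u hu
  rw [hσ.map_smul hM hK (φ := R.mul (σ r u)) (fun x hx => R.mul_mem _ hru x hx)
      (fun x hx y hy => R.hleft_distrib _ hru x hx y hy)
      (.comp₂ R.mul_def (definMapOn_const R.carrier_def _) (fun _ _ => hru) hid fun _ h => h)
      s hs v hv,
    hσ.map_smul hM hK (φ := fun x => R.mul x v) (fun x hx => R.mul_mem x hx v hv)
      (fun x hx y hy => R.hright_distrib x hx y hy v hv)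
      (.comp₂ R.mul_def hid (fun _ h => h) (definMapOn_const R.carrier_def _) fun _ _ => hv)
      r hr u hu,
    ← hσ.2.2.2.2.2 s hs r hr _ (R.mul_mem u hu v hv), hK.1.1 s hs r hr]

end OMin
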